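/- arXiv:1709.05287 — 3 statements merged into one kernel-verified Lean document; each statement's English description precedes it below -/
import Mathlib

section
/- Let ρ ≥ 1 and μ, ν, μ_I, ν_J ∈ P_ρ(ℝ^d) with μ ≤cx ν. Then for any probability measure η⋆ with η⋆ ≤cx ν_J minimizing W_ρ(μ_I, η) over {η : η ≤cx ν_J}, one has W_ρ(μ, η⋆) ≤ 2 W_ρ(μ, μ_I) + W_ρ(ν, ν_J). -/
open MeasureTheory ProbabilityTheory Set
open scoped ENNReal

noncomputable section

/-- `μ ≤cx ν`: convex order between measures on a normed space. -/
def ConvexOrder {E : Type*} [NormedAddCommGroup E] [NormedSpace ℝ E] [MeasurableSpace E]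
    (μ ν : Measure E) : Prop :=
  (∀ φ : E → ℝ, ConvexOn ℝ univ φ → (∀ x, 0 ≤ φ x) →
      ∫⁻ x, ENNReal.ofReal (φ x) ∂μ ≤ ∫⁻ x, ENNReal.ofReal (φ x) ∂ν) ∧
  (∀ φ : E → ℝ, ConvexOn ℝ univ φ → Integrable φ (μ + ν) →
      ∫ x, φ x ∂μ ≤ ∫ x, φ x ∂ν)

/-- `Wp ρ μ ν` is the ρ-th power `W_ρ(μ,ν)^ρ` of the ρ-Wasserstein distance, so that
`W_ρ(μ,ν) = (Wp ρ μ ν) ^ (1/ρ)`. -/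
def Wp {E : Type*} [NormedAddCommGroup E] [MeasurableSpace E]
    (ρ : ℝ) (μ ν : Measure E) : ℝ≥0∞ :=
  ⨅ (π : Measure (E × E)) (_ : π.map Prod.fst = μ) (_ : π.map Prod.snd = ν),
    ∫⁻ p, ENNReal.ofReal (‖p.1 - p.2‖ ^ ρ) ∂π

set_option linter.unusedSectionVars false

namespace Stmt9Aux

section Gen

variable {E : Type*} [NormedAddCommGroup E] [MeasurableSpace E]

lemma ofReal_cost (ρ : ℝ) (hρ : 1 ≤ ρ) (x : E) :
    ENNReal.ofReal (‖x‖ ^ ρ) = ‖x‖ₑ ^ ρ := by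
  rw [← ENNReal.ofReal_rpow_of_nonneg (norm_nonneg _) (by linarith), ofReal_norm]

lemma Wp_rpow (ρ : ℝ) (hρ : 1 ≤ ρ) (μ ν : Measure E) :
    (Wp ρ μ ν) ^ (1 / ρ) =
      ⨅ (π : Measure (E × E)) (_ : π.map Prod.fst = μ) (_ : π.map Prod.snd = ν),
        (∫⁻ p, ‖p.1 - p.2‖ₑ ^ ρ ∂π) ^ (1 / ρ) := by
  have h0 : (0 : ℝ) < 1 / ρ := by positivity
  have := (ENNReal.orderIsoRpow (1 / ρ) h0)
  simp only [Wp, ofReal_cost ρ hρ]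
  change (ENNReal.orderIsoRpow (1 / ρ) h0) _ = _
  simp only [OrderIso.map_iInf]
  rfl

lemma Wp_le (ρ : ℝ) (μ ν : Measure E) (π : Measure (E × E)) (h1 : π.map Prod.fst = μ)
    (h2 : π.map Prod.snd = ν) : Wp ρ μ ν ≤ ∫⁻ p, ENNReal.ofReal (‖p.1 - p.2‖ ^ ρ) ∂π := by
  unfold Wp
  exact iInf_le_of_le π (iInf_le_of_le h1 (iInf_le_of_le h2 le_rfl))

variable [BorelSpace E] [SecondCountableTopology E]

lemma Wp_symm (ρ : ℝ) (μ ν : Measure E) : Wp ρ μ ν = Wp ρ ν μ := by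
  have key : ∀ μ ν : Measure E, Wp ρ μ ν ≤ Wp ρ ν μ := by
    intro μ ν
    rw [Wp.eq_1 ρ ν μ]
    refine le_iInf fun π => le_iInf fun h1 => le_iInf fun h2 => ?_
    refine (Wp_le ρ μ ν (π.map Prod.swap) ?_ ?_).trans ?_
    · rw [Measure.map_map measurable_fst measurable_swap]
      exact h2
    · rw [Measure.map_map measurable_snd measurable_swap]
      exact h1
    · rw [lintegral_map (by fun_prop) measurable_swap]
      simp [norm_sub_rev]
  exact le_antisymm (key _ _) (key _ _)

variable [CompleteSpace E]

lemma glue (π₁ π₂ : Measure (E × E)) [IsFiniteMeasure π₁] [IsFiniteMeasure π₂]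
    (h : π₁.map Prod.snd = π₂.map Prod.fst) :
    ∃ γ : Measure (E × E × E), γ.map (fun p => (p.2.1, p.1)) = π₁ ∧
      γ.map (fun p => (p.1, p.2.2)) = π₂ := by
  have : IsFiniteMeasure (π₁.map Prod.swap) := by infer_instance
  have hf : (π₁.map Prod.swap).fst = π₂.fst := by
    rw [Measure.fst_map_swap]; exact h
  refine ⟨π₂.fst ⊗ₘ ((π₁.map Prod.swap).condKernel ×ₖ π₂.condKernel), ?_, ?_⟩
  · have e : π₂.fst ⊗ₘ (π₁.map Prod.swap).condKernel = π₁.map Prod.swap := by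
      rw [← hf]; exact Measure.disintegrate _ _
    have e2 : ((π₁.map Prod.swap).condKernel ×ₖ π₂.condKernel).map Prod.fst
        = (π₁.map Prod.swap).condKernel := by
      rw [← Kernel.fst_eq, Kernel.fst_prod]
    rw [← e2, Measure.compProd_map measurable_fst] at e
    have e3 := congrArg (Measure.map Prod.swap) e
    rw [Measure.map_map (by fun_prop) (by fun_prop), Measure.map_map (by fun_prop) (by fun_prop)] at e3
    rw [Prod.swap_swap_eq, Measure.map_id] at e3
    exact e3
  · have e : π₂.fst ⊗ₘ π₂.condKernel = π₂ := Measure.disintegrate _ _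
    have e2 : ((π₁.map Prod.swap).condKernel ×ₖ π₂.condKernel).map Prod.snd
        = π₂.condKernel := by
      rw [← Kernel.snd_eq, Kernel.snd_prod]
    rw [← e2, Measure.compProd_map measurable_snd] at e
    exact e

lemma finite_of_map {Ω Ω' : Type*} [MeasurableSpace Ω] [MeasurableSpace Ω'] (π : Measure Ω)
    (f : Ω → Ω') (hf : Measurable f) [h : IsFiniteMeasure (π.map f)] : IsFiniteMeasure π := by
  constructor
  have := h.measure_univ_lt_top
  rwa [Measure.map_apply hf MeasurableSet.univ, preimage_univ] at this

lemma W_triangle (ρ : ℝ) (hρ : 1 ≤ ρ) (α β γ : Measure E) [IsFiniteMeasure α]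
    [IsFiniteMeasure β] :
    (Wp ρ α γ) ^ (1 / ρ) ≤ (Wp ρ α β) ^ (1 / ρ) + (Wp ρ β γ) ^ (1 / ρ) := by
  rw [Wp_rpow ρ hρ α β, Wp_rpow ρ hρ β γ]
  simp only [ENNReal.iInf_add, ENNReal.add_iInf]
  refine le_iInf fun π₂ => le_iInf fun h3 => le_iInf fun h4 => ?_
  refine le_iInf fun π₁ => le_iInf fun h1 => le_iInf fun h2 => ?_
  subst h1
  subst h2
  have : IsFiniteMeasure π₁ := finite_of_map π₁ Prod.fst measurable_fst
  have : IsFiniteMeasure π₂ := by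
    have : IsFiniteMeasure (π₂.map Prod.fst) := by rw [h3]; infer_instance
    exact finite_of_map π₂ Prod.fst measurable_fst
  obtain ⟨g, hg1, hg2⟩ := glue π₁ π₂ h3.symm
  refine (ENNReal.rpow_le_rpow (Wp_le ρ _ _ (g.map fun p => (p.2.1, p.2.2)) ?_ ?_)
    (by positivity)).trans ?_
  · rw [← hg1, Measure.map_map (by fun_prop) (by fun_prop),
      Measure.map_map (by fun_prop) (by fun_prop)]
    rfl
  · rw [← h4, ← hg2, Measure.map_map (by fun_prop) (by fun_prop),
      Measure.map_map (by fun_prop) (by fun_prop)]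
    rfl
  · simp only [ofReal_cost ρ hρ]
    rw [← hg1, ← hg2, lintegral_map (by fun_prop) (by fun_prop),
      lintegral_map (by fun_prop) (by fun_prop), lintegral_map (by fun_prop) (by fun_prop)]
    refine le_trans ?_ (ENNReal.lintegral_Lp_add_le (by fun_prop) (by fun_prop) hρ)
    gcongr with p
    simp only [Pi.add_apply]
    have : p.2.1 - p.2.2 = (p.2.1 - p.1) + (p.1 - p.2.2) := by abel
    rw [this]
    exact enorm_add_le _ _

/-- Coupling cost to a finitely supported measure. -/
lemma Wp_le_sum (ρ : ℝ) (hρ : 1 ≤ ρ) {ι : Type*} [Fintype ι] (m : ι → Measure E) (u : ι → E) :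
    Wp ρ (∑ i, m i) (∑ i, m i univ • Measure.dirac (u i)) ≤
      ∑ i, ∫⁻ x, ‖x - u i‖ₑ ^ ρ ∂(m i) := by
  refine (Wp_le ρ _ _ (∑ i, (m i).map (fun x => (x, u i))) ?_ ?_).trans ?_
  · rw [← Measure.mapₗ_apply_of_measurable measurable_fst, map_sum]
    refine Finset.sum_congr rfl fun i _ => ?_
    rw [Measure.mapₗ_apply_of_measurable measurable_fst, Measure.map_map (by fun_prop) (by fun_prop)]
    exact Measure.map_id
  · rw [← Measure.mapₗ_apply_of_measurable measurable_snd, map_sum]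
    refine Finset.sum_congr rfl fun i _ => ?_
    rw [Measure.mapₗ_apply_of_measurable measurable_snd, Measure.map_map (by fun_prop) (by fun_prop)]
    exact Measure.map_const _ _
  · simp only [ofReal_cost ρ hρ]
    rw [lintegral_finsetSum_measure]
    refine Finset.sum_le_sum fun i _ => ?_
    rw [lintegral_map (by fun_prop) (by fun_prop)]

lemma Wp_discrete_le (ρ : ℝ) (hρ : 1 ≤ ρ) {ι : Type*} [Fintype ι] (p : ι → ℝ≥0∞) (u v : ι → E) :
    Wp ρ (∑ i, p i • Measure.dirac (u i)) (∑ i, p i • Measure.dirac (v i)) ≤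
      ∑ i, p i * ‖u i - v i‖ₑ ^ ρ := by
  have := Wp_le_sum ρ hρ (fun i => p i • Measure.dirac (u i)) v
  simpa [lintegral_dirac] using this

variable [NormedSpace ℝ E]

/-- Jensen for the `ρ`-th power of the norm. -/
lemma jensen_enorm (ρ : ℝ) (hρ : 1 ≤ ρ) {Ω : Type*} [MeasurableSpace Ω] (τ : Measure Ω)
    [IsFiniteMeasure τ] (h : Ω → E) (hh : AEStronglyMeasurable h τ) :
    τ univ * ‖⨍ ω, h ω ∂τ‖ₑ ^ ρ ≤ ∫⁻ ω, ‖h ω‖ₑ ^ ρ ∂τ := by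
  rcases eq_or_ne τ 0 with h0 | h0
  · simp [h0]
  have : NeZero τ := ⟨h0⟩
  have hρ0 : 0 < ρ := by linarith
  have ht : τ univ ≠ 0 := by simpa using h0
  set τ' := (τ univ)⁻¹ • τ with hτ'
  have hh' : AEStronglyMeasurable h τ' := hh.smul_measure _
  have a1 : ‖⨍ ω, h ω ∂τ‖ₑ ≤ eLpNorm h 1 τ' := by
    rw [eLpNorm_one_eq_lintegral_enorm]
    exact enorm_integral_le_lintegral_enorm _
  have a2 : eLpNorm h 1 τ' ≤ eLpNorm h (ENNReal.ofReal ρ) τ' := by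
    refine eLpNorm_le_eLpNorm_of_exponent_le ?_ hh'
    simpa using hρ
  have a3 := a1.trans a2
  rw [eLpNorm_eq_lintegral_rpow_enorm_toReal (by simpa using hρ0) (by simp), ENNReal.toReal_ofReal hρ0.le] at a3
  have a4 := ENNReal.rpow_le_rpow a3 hρ0.le
  rw [← ENNReal.rpow_mul, one_div_mul_cancel hρ0.ne', ENNReal.rpow_one, hτ',
    lintegral_smul_measure] at a4
  calc _ ≤ τ univ * ((τ univ)⁻¹ • ∫⁻ ω, ‖h ω‖ₑ ^ ρ ∂τ) := by gcongr
    _ = _ := by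
      rw [smul_eq_mul, ← mul_assoc, ENNReal.mul_inv_cancel ht (measure_ne_top _ _), one_mul]

end Gen

section Sep

lemma exists_argmax_partition {Ω ι : Type*} [MeasurableSpace Ω] [Fintype ι] [Nonempty ι]
    (g : ι → Ω → ℝ) (hg : ∀ i, Measurable (g i)) :
    ∃ A : ι → Set Ω, (∀ i, MeasurableSet (A i)) ∧ Pairwise (Function.onFun Disjoint A) ∧
      (⋃ i, A i) = univ ∧ ∀ i, ∀ ω ∈ A i, ∀ j, g j ω ≤ g i ω := by
  let _ : LinearOrder ι := LinearOrder.lift' (Fintype.equivFin ι) (Fintype.equivFin ι).injective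
  let B : ι → Set Ω := fun i => {ω | ∀ j, g j ω ≤ g i ω}
  have hB : ∀ i, MeasurableSet (B i) := fun i => by
    have : B i = ⋂ j, {ω | g j ω ≤ g i ω} := by ext; simp [B]
    rw [this]
    exact MeasurableSet.iInter fun j => measurableSet_le (hg j) (hg i)
  refine ⟨fun i => B i \ ⋃ j, ⋃ (_ : j < i), B j, ?_, ?_, ?_, ?_⟩
  · intro i
    exact (hB i).diff (MeasurableSet.iUnion fun j => MeasurableSet.iUnion fun _ => hB j)
  · intro i j hij
    refine Set.disjoint_left.2 fun ω h1 h2 => ?_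
    simp only [mem_sdiff, mem_iUnion, not_exists] at h1 h2
    rcases lt_or_gt_of_ne hij with h | h
    · exact h2.2 i h h1.1
    · exact h1.2 j h h2.1
  · rw [eq_univ_iff_forall]
    intro ω
    have hne : (Finset.univ.filter fun i => ω ∈ B i).Nonempty := by
      obtain ⟨i, -, hi⟩ := Finset.exists_max_image Finset.univ (fun i => g i ω)
        Finset.univ_nonempty
      exact ⟨i, by simpa [B] using hi⟩
    have h1 := Finset.min'_mem _ hne
    refine mem_iUnion.2 ⟨_, (Finset.mem_filter.1 h1).2, ?_⟩
    simp only [mem_iUnion, not_exists]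
    intro j hj hjB
    have := Finset.min'_le (Finset.univ.filter fun i => ω ∈ B i) j (by simpa using hjB)
    exact absurd hj (not_lt.2 this)
  · intro i ω h
    exact h.1

variable {E : Type*} [NormedAddCommGroup E] [NormedSpace ℝ E] [CompleteSpace E]

lemma exists_split_approx {Ω ι : Type*} [MeasurableSpace Ω] [Fintype ι] [Nonempty ι]
    (π : Measure Ω) [IsFiniteMeasure π] (Y : Ω → E) (hY : Integrable Y π)
    (hYm : ∀ b : E →L[ℝ] ℝ, Measurable fun ω => b (Y ω))
    (p : ι → ℝ) (v : ι → E)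
    (hsup : ∀ (a : ι → ℝ) (b : ι → E →L[ℝ] ℝ), ∑ i, (a i * p i + b i (v i)) ≤
      ∫ ω, Finset.univ.sup' Finset.univ_nonempty (fun i => a i + b i (Y ω)) ∂π)
    (δ : ℝ) (hδ : 0 < δ) :
    ∃ τ : ι → Measure Ω, ∑ i, τ i = π ∧ ∀ i, |(τ i).real univ - p i| < δ ∧
      ‖∫ ω, Y ω ∂(τ i) - v i‖ < δ := by
  classical
  let K : Set (ι → ℝ × E) := {w | ∃ τ : ι → Measure Ω, ∑ i, τ i = π ∧
    w = fun i => ((τ i).real univ, ∫ ω, Y ω ∂(τ i))}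
  have hle : ∀ τ : ι → Measure Ω, ∑ i, τ i = π → ∀ i, τ i ≤ π := by
    intro τ h i
    rw [← h]
    exact Finset.single_le_sum (f := τ) (fun j _ => Measure.zero_le _) (Finset.mem_univ i)
  have hfin : ∀ τ : ι → Measure Ω, ∑ i, τ i = π → ∀ i, IsFiniteMeasure (τ i) := by
    intro τ h i
    exact isFiniteMeasure_of_le π (hle τ h i)
  have hYint : ∀ τ : ι → Measure Ω, ∑ i, τ i = π → ∀ i, Integrable Y (τ i) := by
    intro τ h i
    exact hY.mono_measure (hle τ h i)
  have hK : Convex ℝ K := by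
    rintro w ⟨τ, hτ, rfl⟩ w' ⟨τ', hτ', rfl⟩ s t hs ht hst
    refine ⟨fun i => ENNReal.ofReal s • τ i + ENNReal.ofReal t • τ' i, ?_, ?_⟩
    · rw [Finset.sum_add_distrib, ← Finset.smul_sum, ← Finset.smul_sum, hτ, hτ', ← add_smul,
        ← ENNReal.ofReal_add hs ht, hst]
      simp
    · funext i
      have := hfin τ hτ i
      have := hfin τ' hτ' i
      refine Prod.ext ?_ ?_
      · simp only [Pi.add_apply, Pi.smul_apply, Prod.fst_add, Prod.smul_fst]
        rw [measureReal_add_apply (by simp [ENNReal.mul_eq_top]) (by simp [ENNReal.mul_eq_top])]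
        simp [measureReal_ennreal_smul_apply, hs, ht]
      · simp only [Pi.add_apply, Pi.smul_apply, Prod.snd_add, Prod.smul_snd]
        rw [integral_add_measure ((hYint τ hτ i).smul_measure (by simp))
          ((hYint τ' hτ' i).smul_measure (by simp))]
        simp [integral_smul_measure, hs, ht]
  have hmem : (fun i => (p i, v i)) ∈ closure K := by
    by_contra hnot
    obtain ⟨f, c, hf1, hf2⟩ := geometric_hahn_banach_closed_point hK.closure isClosed_closure hnot
    let a : ι → ℝ := fun i => f (Pi.single i (1, 0))
    let b : ι → E →L[ℝ] ℝ := fun i =>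
      (f.comp (ContinuousLinearMap.single ℝ (fun _ : ι => ℝ × E) i)).comp
        (ContinuousLinearMap.inr ℝ ℝ E)
    have hfw : ∀ w : ι → ℝ × E, f w = ∑ i, (a i * (w i).1 + b i (w i).2) := by
      intro w
      have hw : w = ∑ i, ((w i).1 • (Pi.single i ((1 : ℝ), (0 : E)) : ι → ℝ × E)
          + Pi.single i ((0 : ℝ), (w i).2)) := by
        funext j
        simp only [Finset.sum_apply, Pi.add_apply, Pi.smul_apply]
        rw [Finset.sum_eq_single j]
        · simp
        · intro i _ hij
          simp [Pi.single_eq_of_ne' hij]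
        · simp
      conv_lhs => rw [hw]
      rw [map_sum]
      refine Finset.sum_congr rfl fun i _ => ?_
      rw [map_add, map_smul, smul_eq_mul, mul_comm]
      rfl
    obtain ⟨A, hAm, hAd, hAu, hA⟩ := exists_argmax_partition (fun i ω => a i + b i (Y ω))
      (fun i => (hYm (b i)).const_add _)
    have hτ : ∑ i, π.restrict (A i) = π := by
      rw [← Measure.sum_fintype, ← Measure.restrict_iUnion hAd hAm, hAu, Measure.restrict_univ]
    have h1 := hf1 _ (subset_closure ⟨fun i => π.restrict (A i), hτ, rfl⟩)
    have h2 : ∑ i, (a i * p i + b i (v i)) ≤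
        ∑ i, (a i * (π.restrict (A i)).real univ + b i (∫ ω, Y ω ∂(π.restrict (A i)))) := by
      refine (hsup a b).trans (le_of_eq ?_)
      have hgi : ∀ i, Integrable (fun ω => a i + b i (Y ω)) π := fun i =>
        (integrable_const _).add ((b i).integrable_comp hY)
      have hsi : Integrable (fun ω => Finset.univ.sup' Finset.univ_nonempty
          (fun i => a i + b i (Y ω))) π := by
        have : (fun ω => Finset.univ.sup' Finset.univ_nonempty (fun i => a i + b i (Y ω)))
          = Finset.univ.sup' Finset.univ_nonempty (fun i ω => a i + b i (Y ω)) := by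
          funext ω; rw [Finset.sup'_apply]
        rw [this]
        exact Finset.sup'_induction (p := fun f => Integrable f π) Finset.univ_nonempty _
          (fun f hf g hg => hf.sup hg)
          (fun i _ => hgi i)
      nth_rewrite 1 [← hτ]
      rw [integral_finsetSum_measure (fun i _ => hsi.restrict)]
      refine Finset.sum_congr rfl fun i _ => ?_
      rw [setIntegral_congr_fun (g := fun ω => a i + b i (Y ω)) (hAm i) ?_,
        integral_add (integrable_const _) ((b i).integrable_comp hY).restrict,
        ContinuousLinearMap.integral_comp_comm _ hY.restrict]
      · simp [mul_comm]
      · intro ω hω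
        refine le_antisymm (Finset.sup'_le _ _ fun j _ => hA i ω hω j) ?_
        exact Finset.le_sup' (fun i => a i + b i (Y ω)) (Finset.mem_univ i)
    rw [hfw] at h1 hf2
    linarith
  obtain ⟨w, ⟨τ, hτ, rfl⟩, hd⟩ := Metric.mem_closure_iff.1 hmem δ hδ
  refine ⟨τ, hτ, fun i => ?_⟩
  have h3 := (dist_pi_lt_iff hδ).1 hd i
  rw [dist_comm, Prod.dist_eq, max_lt_iff, Real.dist_eq, dist_eq_norm] at h3
  exact h3

/-- The same with exact masses. -/
lemma exists_split {Ω ι : Type*} [MeasurableSpace Ω] [Fintype ι] [Nonempty ι]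
    (π : Measure Ω) [IsProbabilityMeasure π] (Y : Ω → E) (hY : Integrable Y π)
    (hYm : ∀ b : E →L[ℝ] ℝ, Measurable fun ω => b (Y ω))
    (p : ι → ℝ) (hp : ∀ i, 0 < p i) (hp1 : ∑ i, p i = 1) (v : ι → E)
    (hsup : ∀ (a : ι → ℝ) (b : ι → E →L[ℝ] ℝ), ∑ i, (a i * p i + b i (v i)) ≤
      ∫ ω, Finset.univ.sup' Finset.univ_nonempty (fun i => a i + b i (Y ω)) ∂π)
    (ε : ℝ) (hε : 0 < ε) :
    ∃ τ : ι → Measure Ω, ∑ i, τ i = π ∧ ∀ i, (τ i).real univ = p i ∧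
      ‖∫ ω, Y ω ∂(τ i) - v i‖ < ε := by
  -- choose the mixing parameter
  set y := ∫ ω, Y ω ∂π with hy
  obtain ⟨C, hC0, hC⟩ : ∃ C : ℝ, 0 < C ∧ ∀ i, ‖v i‖ + ‖y‖ ≤ C := by
    refine ⟨∑ i, ‖v i‖ + ‖y‖ + 1, by positivity, fun i => ?_⟩
    have := Finset.single_le_sum (f := fun i => ‖v i‖) (fun j _ => norm_nonneg _)
      (Finset.mem_univ i)
    linarith
  set s : ℝ := min (1 / 2) (ε / (4 * C)) with hs
  have hs0 : 0 < s := by positivity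
  have hs1 : s ≤ 1 / 2 := min_le_left _ _
  have hsC : s * C ≤ ε / 4 := by
    have : s ≤ ε / (4 * C) := min_le_right _ _
    calc s * C ≤ ε / (4 * C) * C := by gcongr
      _ = ε / 4 := by field_simp
  obtain ⟨i0, -, hi0⟩ := Finset.exists_min_image Finset.univ p Finset.univ_nonempty
  obtain ⟨τ, hτ, hτ'⟩ := exists_split_approx π Y hY hYm p v hsup (min (ε / 2) (s * p i0))
    (lt_min (by positivity) (mul_pos hs0 (hp i0)))
  have hle : ∀ i, τ i ≤ π := by
    intro i
    rw [← hτ]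
    exact Finset.single_le_sum (f := τ) (fun j _ => Measure.zero_le _) (Finset.mem_univ i)
  have hfin : ∀ i, IsFiniteMeasure (τ i) := fun i => isFiniteMeasure_of_le π (hle i)
  have hq1 : ∑ i, (τ i).real univ = 1 := by
    have : π.real univ = 1 := by simp
    rw [← this, ← hτ]
    simp only [Measure.real, Measure.coe_finsetSum, Finset.sum_apply]
    rw [ENNReal.toReal_sum]
    intro i _
    exact measure_ne_top _ _
  let c : ι → ℝ := fun i => p i - (1 - s) * (τ i).real univ
  have hc0 : ∀ i, 0 ≤ c i := by
    intro i
    have h1 := (abs_lt.1 ((hτ' i).1.trans_le (min_le_right _ _))).2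
    have h2 := hi0 i (Finset.mem_univ i)
    have h3 : 0 < p i := hp i
    have h4 : s * p i0 ≤ s * p i := by gcongr
    have h5 : (τ i).real univ ≤ (1 + s) * p i := by linarith
    have h6 : (1 - s) * (τ i).real univ ≤ (1 - s) * ((1 + s) * p i) := by
      apply mul_le_mul_of_nonneg_left h5; linarith
    simp only [c]
    nlinarith [mul_pos (mul_pos hs0 hs0) h3]
  have hcs : ∑ i, c i = s := by
    simp only [c, Finset.sum_sub_distrib, ← Finset.mul_sum, hq1, hp1]
    ring
  have hcle : ∀ i, c i ≤ s := by
    intro i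
    rw [← hcs]
    exact Finset.single_le_sum (fun j _ => hc0 j) (Finset.mem_univ i)
  have h1s : 0 ≤ 1 - s := by linarith
  refine ⟨fun i => ENNReal.ofReal (1 - s) • τ i + ENNReal.ofReal (c i) • π, ?_, fun i => ⟨?_, ?_⟩⟩
  · rw [Finset.sum_add_distrib, ← Finset.smul_sum, hτ, ← Finset.sum_smul,
      ← ENNReal.ofReal_sum_of_nonneg (fun i _ => hc0 i), hcs, ← add_smul,
      ← ENNReal.ofReal_add h1s hs0.le]
    simp
  · rw [measureReal_add_apply (by simp [ENNReal.mul_eq_top]) (by simp [ENNReal.mul_eq_top])]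
    simp [measureReal_ennreal_smul_apply, h1s, hc0 i, c]
  · rw [integral_add_measure ((hY.mono_measure (hle i)).smul_measure (by simp))
          (hY.smul_measure (by simp)), integral_smul_measure, integral_smul_measure,
          ENNReal.toReal_ofReal h1s, ENNReal.toReal_ofReal (hc0 i), ← hy]
    have e : (1 - s) • ∫ ω, Y ω ∂(τ i) + c i • y - v i =
        (1 - s) • (∫ ω, Y ω ∂(τ i) - v i) + (c i • y - s • v i) := by
      module
    rw [e]
    have b1 : ‖(1 - s) • (∫ ω, Y ω ∂(τ i) - v i)‖ ≤ ε / 2 := by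
      rw [norm_smul, Real.norm_of_nonneg h1s]
      have := ((hτ' i).2.trans_le (min_le_left _ _)).le
      calc _ ≤ 1 * (ε / 2) := by gcongr; linarith
        _ = _ := one_mul _
    have b2 : ‖c i • y - s • v i‖ ≤ ε / 4 := by
      refine (norm_sub_le _ _).trans ?_
      rw [norm_smul, norm_smul, Real.norm_of_nonneg (hc0 i), Real.norm_of_nonneg hs0.le]
      calc c i * ‖y‖ + s * ‖v i‖ ≤ s * ‖y‖ + s * ‖v i‖ := by gcongr; exact hcle i
        _ = s * (‖v i‖ + ‖y‖) := by ring
        _ ≤ s * C := by gcongr; exact hC i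
        _ ≤ _ := hsC
    have := norm_add_le ((1 - s) • (∫ ω, Y ω ∂(τ i) - v i)) (c i • y - s • v i)
    linarith

end Sep

section Main

variable {E : Type*} [NormedAddCommGroup E] [NormedSpace ℝ E] [FiniteDimensional ℝ E]
  [CompleteSpace E] [SecondCountableTopology E] [MeasurableSpace E] [BorelSpace E]

lemma integrable_id_of_rpow (ρ : ℝ) (hρ : 1 ≤ ρ) (μ : Measure E) [IsFiniteMeasure μ]
    (h : Integrable (fun x => ‖x‖ ^ ρ) μ) : MemLp (fun x : E => x) (ENNReal.ofReal ρ) μ := by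
  have hρ0 : 0 < ρ := by linarith
  rw [← integrable_norm_rpow_iff (by fun_prop) (by simpa using hρ0) (by simp),
    ENNReal.toReal_ofReal hρ0.le]
  exact h

lemma exists_decomp (ρ : ℝ) (hρ : 1 ≤ ρ) (μ : Measure E) [IsProbabilityMeasure μ]
    (h : MemLp (fun x : E => x) (ENNReal.ofReal ρ) μ) (ε : ℝ) (hε : 0 < ε) :
    ∃ (s : Finset E) (m : E → Measure E), (∀ i ∈ s, m i ≠ 0) ∧ ∑ i ∈ s, m i = μ ∧
      ∑ i ∈ s, ∫⁻ x, ‖x - i‖ₑ ^ ρ ∂(m i) ≤ ENNReal.ofReal ε ^ ρ := by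
  classical
  have hρ0 : 0 < ρ := by linarith
  have ht := SimpleFunc.tendsto_approxOn_Lp_eLpNorm (f := fun x : E => x) measurable_id
    (s := univ) (y₀ := 0) (mem_univ _) (p := ENNReal.ofReal ρ) (by simp) (μ := μ)
    (by simp) (by simpa using h.2)
  obtain ⟨n, hn⟩ := ((ENNReal.tendsto_nhds_zero.1 ht) (ENNReal.ofReal ε) (by simpa using hε)).exists
  set f := SimpleFunc.approxOn (fun x : E => x) measurable_id univ 0 (mem_univ _) n with hf
  let m : E → Measure E := fun r => μ.restrict (f ⁻¹' {r})
  have hsum : ∑ r ∈ f.range, m r = μ := by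
    have : μ.restrict (⋃ r ∈ f.range, f ⁻¹' {r}) = μ := by
      have : (⋃ r ∈ f.range, f ⁻¹' {r}) = univ := by
        rw [eq_univ_iff_forall]
        intro x
        simp
      rw [this, Measure.restrict_univ]
    rw [Measure.restrict_biUnion_finset] at this
    · rw [← Measure.sum_coe_finset]
      exact this
    · intro a _ b _ hab
      exact Disjoint.preimage _ (by simpa using hab)
    · intro b
      exact f.measurableSet_fiber b
  have hcost : ∑ r ∈ f.range, ∫⁻ x, ‖x - r‖ₑ ^ ρ ∂(m r) ≤ ENNReal.ofReal ε ^ ρ := by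
    calc ∑ r ∈ f.range, ∫⁻ x, ‖x - r‖ₑ ^ ρ ∂(m r)
        = ∑ r ∈ f.range, ∫⁻ x, ‖x - f x‖ₑ ^ ρ ∂(m r) := by
          refine Finset.sum_congr rfl fun r _ => ?_
          refine setLIntegral_congr_fun (f.measurableSet_fiber r) fun x hx => ?_
          have : f x = r := hx
          simp [this]
      _ = ∫⁻ x, ‖x - f x‖ₑ ^ ρ ∂μ := by
          rw [← lintegral_finsetSum_measure, hsum]
      _ = (eLpNorm (⇑f - fun x => x) (ENNReal.ofReal ρ) μ) ^ ρ := by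
          rw [eLpNorm_eq_lintegral_rpow_enorm_toReal (by simpa using hρ0) (by simp),
            ENNReal.toReal_ofReal hρ0.le, ← ENNReal.rpow_mul, one_div_mul_cancel hρ0.ne',
            ENNReal.rpow_one]
          refine lintegral_congr fun x => ?_
          rw [← enorm_neg]
          simp
      _ ≤ _ := by gcongr
  refine ⟨f.range.filter (fun r => m r ≠ 0), m, ?_, ?_, ?_⟩
  · intro i hi
    exact (Finset.mem_filter.1 hi).2
  · rw [Finset.sum_filter_ne_zero, hsum]
  · exact (Finset.sum_le_sum_of_subset (Finset.filter_subset _ _)).trans hcost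

lemma convexOn_sup' {ι : Type*} [Fintype ι] [Nonempty ι] (a : ι → ℝ) (b : ι → E →L[ℝ] ℝ) :
    ConvexOn ℝ univ (fun y : E => Finset.univ.sup' Finset.univ_nonempty
      (fun i => a i + b i y)) := by
  have : (fun y : E => Finset.univ.sup' Finset.univ_nonempty (fun i => a i + b i y))
      = Finset.univ.sup' Finset.univ_nonempty (fun i y => a i + b i y) := by
    funext y; rw [Finset.sup'_apply]
  rw [this]
  refine Finset.sup'_induction (p := fun f => ConvexOn ℝ univ f) Finset.univ_nonempty _
    (fun f hf g hg => hf.sup hg) (fun i _ => ?_)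
  exact (convexOn_const (a i) convex_univ).add ((b i).toLinearMap.convexOn convex_univ)

lemma integrable_sup' {ι : Type*} [Fintype ι] [Nonempty ι] (a : ι → ℝ) (b : ι → E →L[ℝ] ℝ)
    (μ : Measure E) [IsFiniteMeasure μ] (h : Integrable (fun x => x) μ) :
    Integrable (fun y : E => Finset.univ.sup' Finset.univ_nonempty
      (fun i => a i + b i y)) μ := by
  have : (fun y : E => Finset.univ.sup' Finset.univ_nonempty (fun i => a i + b i y))
      = Finset.univ.sup' Finset.univ_nonempty (fun i y => a i + b i y) := by
    funext y; rw [Finset.sup'_apply]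
  rw [this]
  refine Finset.sup'_induction (p := fun f => Integrable f μ) Finset.univ_nonempty _
    (fun f hf g hg => hf.sup hg) (fun i _ => ?_)
  exact (integrable_const _).add ((b i).integrable_comp h)

lemma convexOrder_bary {Ω ι : Type*} [MeasurableSpace Ω] [Fintype ι] (π : Measure Ω)
    [IsFiniteMeasure π] (Z : Ω → E) (hZm : Measurable Z) (hZ : Integrable Z π)
    (τ : ι → Measure Ω) (hτ : ∑ i, τ i = π) (h0 : ∀ i, τ i ≠ 0) :
    ConvexOrder (∑ i, τ i univ • Measure.dirac (⨍ ω, Z ω ∂(τ i))) (π.map Z) := by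
  have hle : ∀ i, τ i ≤ π := by
    intro i
    rw [← hτ]
    exact Finset.single_le_sum (f := τ) (fun j _ => Measure.zero_le _) (Finset.mem_univ i)
  have hfin : ∀ i, IsFiniteMeasure (τ i) := fun i => isFiniteMeasure_of_le π (hle i)
  have key : ∀ φ : E → ℝ, ConvexOn ℝ univ φ → Integrable φ (π.map Z) →
      ∑ i, (τ i).real univ * φ (⨍ ω, Z ω ∂(τ i)) ≤ ∫ x, φ x ∂(π.map Z) := by
    intro φ hφ hi
    have hi' : Integrable (fun ω => φ (Z ω)) π := hi.comp_measurable hZm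
    rw [integral_map hZm.aemeasurable hi.1]
    conv_rhs => rw [← hτ]
    rw [integral_finsetSum_measure (fun i _ => hi'.mono_measure (hle i))]
    refine Finset.sum_le_sum fun i _ => ?_
    have : NeZero (τ i) := ⟨h0 i⟩
    have hp : 0 < (τ i).real univ := measureReal_univ_pos
    have hJ := hφ.map_average_le (μ := τ i) (f := Z) hφ.locallyLipschitz.continuous.continuousOn
      isClosed_univ (by simp) (hZ.mono_measure (hle i)) (hi'.mono_measure (hle i))
    rw [average_eq _ (fun ω => φ (Z ω)), smul_eq_mul] at hJ
    calc _ ≤ (τ i).real univ * (((τ i).real univ)⁻¹ * ∫ ω, φ (Z ω) ∂(τ i)) := by gcongr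
      _ = _ := by rw [mul_inv_cancel_left₀ hp.ne']
  constructor
  · intro φ hφ hnn
    have hc : Continuous φ := hφ.locallyLipschitz.continuous
    by_cases htop : ∫⁻ x, ENNReal.ofReal (φ x) ∂(π.map Z) = ⊤
    · rw [htop]; exact le_top
    have hi : Integrable φ (π.map Z) := by
      refine ⟨hc.aestronglyMeasurable, ?_⟩
      rw [hasFiniteIntegral_iff_ofReal (Filter.Eventually.of_forall hnn)]
      exact lt_top_iff_ne_top.2 htop
    have hk := key φ hφ hi
    rw [← ofReal_integral_eq_lintegral_ofReal hi (Filter.Eventually.of_forall hnn)]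
    refine le_trans (le_of_eq ?_) (ENNReal.ofReal_le_ofReal hk)
    rw [ENNReal.ofReal_sum_of_nonneg (fun i _ => mul_nonneg measureReal_nonneg (hnn _)),
      lintegral_finsetSum_measure]
    refine Finset.sum_congr rfl fun i _ => ?_
    rw [lintegral_smul_measure, lintegral_dirac, ENNReal.ofReal_mul measureReal_nonneg,
      ofReal_measureReal, smul_eq_mul]
  · intro φ hφ hi
    refine le_trans (le_of_eq ?_) (key φ hφ (hi.mono_measure (Measure.le_add_left le_rfl)))
    rw [integral_finsetSum_measure]
    · refine Finset.sum_congr rfl fun i _ => ?_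
      rw [integral_smul_measure, integral_dirac]
      rfl
    · intro i _
      exact (integrable_dirac (by simp)).smul_measure (measure_ne_top _ _)

lemma key (ρ : ℝ) (hρ : 1 ≤ ρ) (μ ν : Measure E) [IsProbabilityMeasure μ]
    [IsProbabilityMeasure ν] (νJ : Measure E) [IsProbabilityMeasure νJ]
    (hμ : MemLp (fun x : E => x) (ENNReal.ofReal ρ) μ)
    (hν : Integrable (fun x : E => x) ν) (hνJ : Integrable (fun x : E => x) νJ)
    (hcx : ConvexOrder μ ν) (π : Measure (E × E)) (h1 : π.map Prod.fst = ν)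
    (h2 : π.map Prod.snd = νJ) (ε : ℝ) (hε : 0 < ε) :
    ∃ η : Measure E, IsProbabilityMeasure η ∧ ConvexOrder η νJ ∧
      (Wp ρ μ η) ^ (1 / ρ) ≤ (∫⁻ p, ‖p.1 - p.2‖ₑ ^ ρ ∂π) ^ (1 / ρ) + 3 * ENNReal.ofReal ε := by
  have hρ0 : 0 < ρ := by linarith
  have hμ1 : Integrable (fun x : E => x) μ := hμ.integrable (by simpa using hρ)
  have hπp : IsProbabilityMeasure π := by
    constructor
    have := measure_univ (μ := ν)
    rwa [← h1, Measure.map_apply measurable_fst MeasurableSet.univ, preimage_univ] at this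
  have hY : Integrable (fun ω : E × E => ω.1) π := by
    rw [← h1] at hν
    exact hν.comp_measurable measurable_fst
  have hZ : Integrable (fun ω : E × E => ω.2) π := by
    rw [← h2] at hνJ
    exact hνJ.comp_measurable measurable_snd
  obtain ⟨s, m', hm0, hms, hmc⟩ := exists_decomp ρ hρ μ hμ ε hε
  let ι := {x // x ∈ s}
  let m : ι → Measure E := fun i => m' i
  have hm0 : ∀ i, m i ≠ 0 := fun i => hm0 i i.2
  have hms : ∑ i, m i = μ := by
    rw [← hms]; exact Finset.sum_coe_sort s m'
  have hmc : ∑ i : ι, ∫⁻ x, ‖x - i‖ₑ ^ ρ ∂(m i) ≤ ENNReal.ofReal ε ^ ρ := by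
    refine le_trans (le_of_eq ?_) hmc
    exact Finset.sum_coe_sort s (fun i => ∫⁻ x, ‖x - i‖ₑ ^ ρ ∂(m' i))
  clear_value m
  have hmle : ∀ i, m i ≤ μ := by
    intro i
    rw [← hms]
    exact Finset.single_le_sum (f := m) (fun j _ => Measure.zero_le _) (Finset.mem_univ i)
  have hmfin : ∀ i, IsFiniteMeasure (m i) := fun i => isFiniteMeasure_of_le μ (hmle i)
  have hne : Nonempty ι := by
    by_contra hcon
    rw [not_nonempty_iff] at hcon
    have : μ = 0 := by rw [← hms]; simp
    exact IsProbabilityMeasure.ne_zero μ this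
  let p : ι → ℝ := fun i => (m i).real univ
  have hp : ∀ i, 0 < p i := by
    intro i
    have : NeZero (m i) := ⟨hm0 i⟩
    exact measureReal_univ_pos
  have hpo : ∀ i, ENNReal.ofReal (p i) = m i univ := fun i => ofReal_measureReal
  have hPs : ∑ i, m i univ = 1 := by
    have : μ univ = 1 := measure_univ
    rw [← hms] at this
    simpa using this
  have hp1 : ∑ i, p i = 1 := by
    have : (∑ i, m i univ).toReal = 1 := by rw [hPs]; simp
    rwa [ENNReal.toReal_sum (fun i _ => measure_ne_top _ _)] at this
  have hsup : ∀ (a : ι → ℝ) (b : ι → E →L[ℝ] ℝ), ∑ i, (a i * p i + b i (∫ x, x ∂(m i))) ≤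
      ∫ ω, Finset.univ.sup' Finset.univ_nonempty (fun i => a i + b i ω.1) ∂π := by
    intro a b
    have e1 := hcx.2 _ (convexOn_sup' a b)
      ((integrable_sup' a b μ hμ1).add_measure (integrable_sup' a b ν hν))
    rw [← h1, integral_map measurable_fst.aemeasurable] at e1
    · refine le_trans ?_ e1
      conv_rhs => rw [← hms]
      rw [integral_finsetSum_measure
        (fun i _ => (integrable_sup' a b μ hμ1).mono_measure (hmle i))]
      refine Finset.sum_le_sum fun i _ => ?_
      have hbi : Integrable (fun x => b i x) (m i) :=
        (b i).integrable_comp (hμ1.mono_measure (hmle i))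
      have : a i * p i + b i (∫ x, x ∂(m i)) = ∫ x, (a i + b i x) ∂(m i) := by
        rw [integral_add (integrable_const _) hbi,
          ContinuousLinearMap.integral_comp_comm _ (hμ1.mono_measure (hmle i))]
        simp [p, mul_comm]
      rw [this]
      refine integral_mono ((integrable_const _).add hbi)
        ((integrable_sup' a b μ hμ1).mono_measure (hmle i)) fun x => ?_
      exact Finset.le_sup' (fun i => a i + b i x) (Finset.mem_univ i)
    · rw [h1]; exact (integrable_sup' a b ν hν).1
  obtain ⟨i0, -, hi0⟩ := Finset.exists_min_image Finset.univ p Finset.univ_nonempty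
  obtain ⟨τ, hτ, hτ'⟩ := exists_split π (fun ω : E × E => ω.1) hY (fun b => by fun_prop)
    p hp hp1 (fun i => ∫ x, x ∂(m i)) hsup (ε * p i0) (mul_pos hε (hp i0))
  have hle : ∀ i, τ i ≤ π := by
    intro i
    rw [← hτ]
    exact Finset.single_le_sum (f := τ) (fun j _ => Measure.zero_le _) (Finset.mem_univ i)
  have hfin : ∀ i, IsFiniteMeasure (τ i) := fun i => isFiniteMeasure_of_le π (hle i)
  have hτu : ∀ i, τ i univ = m i univ := by
    intro i
    rw [← hpo i, ← (hτ' i).1, ofReal_measureReal]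
  have hτ0 : ∀ i, τ i ≠ 0 := by
    intro i h
    have := hτ' i
    have h3 := hp i
    rw [← (hτ' i).1, h] at h3
    simp at h3
  let U : ι → E := fun i => i.1
  let S : ι → E := fun i => ⨍ x, x ∂(m i)
  let M : ι → E := fun i => ⨍ ω, ω.1 ∂(τ i)
  let z : ι → E := fun i => ⨍ ω, ω.2 ∂(τ i)
  let D : (ι → E) → Measure E := fun u => ∑ i, m i univ • Measure.dirac (u i)
  have hD : ∀ u, IsProbabilityMeasure (D u) := by
    intro u
    constructor
    simp [D, hPs]
  have hroot : ∀ a : ℝ≥0∞, (a ^ ρ) ^ (1 / ρ) = a := by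
    intro a
    rw [← ENNReal.rpow_mul, mul_one_div_cancel hρ0.ne', ENNReal.rpow_one]
  have hr0 : 0 ≤ 1 / ρ := by positivity
  have w1 : (Wp ρ μ (D U)) ^ (1 / ρ) ≤ ENNReal.ofReal ε := by
    rw [← hroot (ENNReal.ofReal ε)]
    refine ENNReal.rpow_le_rpow ?_ hr0
    have := Wp_le_sum ρ hρ m (fun i : ι => (i : E))
    rw [hms] at this
    exact this.trans hmc
  have w2 : (Wp ρ (D U) (D S)) ^ (1 / ρ) ≤ ENNReal.ofReal ε := by
    rw [← hroot (ENNReal.ofReal ε)]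
    refine ENNReal.rpow_le_rpow ?_ hr0
    refine (Wp_discrete_le ρ hρ (fun i => m i univ) U S).trans (le_trans ?_ hmc)
    refine Finset.sum_le_sum fun i _ => ?_
    have hJ := jensen_enorm ρ hρ (m i) (fun x => x - U i)
      ((measurable_id.sub_const (U i)).aestronglyMeasurable)
    have e : ⨍ x, (x - U i) ∂(m i) = S i - U i := by
      have : NeZero (m i) := ⟨hm0 i⟩
      rw [average_eq, integral_sub (hμ1.mono_measure (hmle i)) (integrable_const _), smul_sub,
        ← average_eq, ← average_eq, average_const]
    rw [e, ← enorm_neg, neg_sub] at hJ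
    exact hJ
  have w3 : (Wp ρ (D S) (D M)) ^ (1 / ρ) ≤ ENNReal.ofReal ε := by
    rw [← hroot (ENNReal.ofReal ε)]
    refine ENNReal.rpow_le_rpow ?_ hr0
    refine (Wp_discrete_le ρ hρ (fun i => m i univ) _ _).trans ?_
    calc ∑ i, m i univ * ‖S i - M i‖ₑ ^ ρ ≤ ∑ i, m i univ * ENNReal.ofReal ε ^ ρ := by
          gcongr with i
          rw [← ofReal_norm]
          apply ENNReal.ofReal_le_ofReal
          have hb := (hτ' i).2
          have e : S i - M i = -((p i)⁻¹ • (∫ ω, ω.1 ∂(τ i) - ∫ x, x ∂(m i))) := by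
            simp only [S, M, average_eq, (hτ' i).1]
            rw [smul_sub, neg_sub]
          rw [e, norm_neg, norm_smul, norm_inv, Real.norm_of_nonneg (hp i).le,
            inv_mul_le_iff₀ (hp i)]
          have := hi0 i (Finset.mem_univ i)
          nlinarith
      _ = ENNReal.ofReal ε ^ ρ := by rw [← Finset.sum_mul, hPs, one_mul]
  have w4 : (Wp ρ (D M) (D z)) ^ (1 / ρ) ≤ (∫⁻ p, ‖p.1 - p.2‖ₑ ^ ρ ∂π) ^ (1 / ρ) := by
    refine ENNReal.rpow_le_rpow ?_ hr0
    refine (Wp_discrete_le ρ hρ (fun i => m i univ) _ _).trans ?_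
    conv_rhs => rw [← hτ]
    rw [lintegral_finsetSum_measure]
    refine Finset.sum_le_sum fun i _ => ?_
    have hJ := jensen_enorm ρ hρ (τ i) (fun ω : E × E => ω.1 - ω.2) (by fun_prop)
    have e : ⨍ ω, (ω.1 - ω.2) ∂(τ i) = M i - z i := by
      rw [average_eq, integral_sub (hY.mono_measure (hle i)) (hZ.mono_measure (hle i)), smul_sub,
        ← average_eq, ← average_eq]
    rw [e, hτu i] at hJ
    exact hJ
  refine ⟨D z, hD z, ?_, ?_⟩
  · have := convexOrder_bary π (fun ω : E × E => ω.2) measurable_snd hZ τ hτ hτ0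
    simp only [hτu] at this
    rw [← h2]
    exact this
  · have t1 := W_triangle ρ hρ μ (D U) (D z)
    have t2 := W_triangle ρ hρ (D U) (D S) (D z)
    have t3 := W_triangle ρ hρ (D S) (D M) (D z)
    calc _ ≤ ENNReal.ofReal ε + (ENNReal.ofReal ε + (ENNReal.ofReal ε +
          (∫⁻ p, ‖p.1 - p.2‖ₑ ^ ρ ∂π) ^ (1 / ρ))) := by
          refine t1.trans (add_le_add w1 (t2.trans (add_le_add w2 (t3.trans (add_le_add w3 w4)))))
      _ = _ := by ring

end Main

end Stmt9Aux

/-- for `ρ ≥ 1`, `μ, ν, μ_I, ν_J ∈ P_ρ(ℝ^d)` with `μ ≤cx ν`, any minimizer `η⋆`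
of `W_ρ(μ_I, ·)` over `{η : η ≤cx ν_J}` satisfies
`W_ρ(μ, η⋆) ≤ 2 W_ρ(μ, μ_I) + W_ρ(ν, ν_J)`. -/
theorem stmt9 {d : ℕ} (ρ : ℝ) (hρ : 1 ≤ ρ)
    (μ ν μI νJ : Measure (EuclideanSpace ℝ (Fin d)))
    [IsProbabilityMeasure μ] [IsProbabilityMeasure ν]
    [IsProbabilityMeasure μI] [IsProbabilityMeasure νJ]
    (hμρ : Integrable (fun x => ‖x‖ ^ ρ) μ) (hνρ : Integrable (fun x => ‖x‖ ^ ρ) ν)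
    (hμIρ : Integrable (fun x => ‖x‖ ^ ρ) μI) (hνJρ : Integrable (fun x => ‖x‖ ^ ρ) νJ)
    (hcx : ConvexOrder μ ν)
    (ηs : Measure (EuclideanSpace ℝ (Fin d))) [IsProbabilityMeasure ηs]
    (hηscx : ConvexOrder ηs νJ)
    (hηsmin : Wp ρ μI ηs = ⨅ (η : Measure (EuclideanSpace ℝ (Fin d)))
        (_ : IsProbabilityMeasure η) (_ : ConvexOrder η νJ), Wp ρ μI η) :
    (Wp ρ μ ηs) ^ (1 / ρ) ≤ 2 * (Wp ρ μ μI) ^ (1 / ρ) + (Wp ρ ν νJ) ^ (1 / ρ) := by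
  have hμ' := Stmt9Aux.integrable_id_of_rpow ρ hρ μ hμρ
  have hν' := (Stmt9Aux.integrable_id_of_rpow ρ hρ ν hνρ).integrable (by simpa using hρ)
  have hνJ' := (Stmt9Aux.integrable_id_of_rpow ρ hρ νJ hνJρ).integrable (by simpa using hρ)
  have hr0 : 0 ≤ 1 / ρ := by positivity
  rw [Stmt9Aux.Wp_rpow ρ hρ ν νJ]
  simp only [ENNReal.add_iInf]
  refine le_iInf fun π => le_iInf fun h1 => le_iInf fun h2 => ?_
  refine ENNReal.le_of_forall_pos_le_add fun ε hε _ => ?_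
  have hε3 : (0 : ℝ) < ε / 3 := by positivity
  obtain ⟨η, hη, hηcx, hW⟩ := Stmt9Aux.key ρ hρ μ ν νJ hμ' hν' hνJ' hcx π h1 h2 (ε / 3) hε3
  have e3 : 3 * ENNReal.ofReal ((ε : ℝ) / 3) = ε := by
    rw [ENNReal.ofReal_div_of_pos (by norm_num), ENNReal.ofReal_coe_nnreal]
    simp only [ENNReal.ofReal_ofNat]
    exact ENNReal.mul_div_cancel (by norm_num) (by norm_num)
  rw [e3] at hW
  have hmin : Wp ρ μI ηs ≤ Wp ρ μI η := by
    rw [hηsmin]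
    exact iInf_le_of_le η (iInf_le_of_le hη (iInf_le_of_le hηcx le_rfl))
  have t1 := Stmt9Aux.W_triangle ρ hρ μ μI ηs
  have t2 := Stmt9Aux.W_triangle ρ hρ μI μ η
  rw [Stmt9Aux.Wp_symm ρ μI μ] at t2
  calc (Wp ρ μ ηs) ^ (1 / ρ)
      ≤ (Wp ρ μ μI) ^ (1 / ρ) + (Wp ρ μI ηs) ^ (1 / ρ) := t1
    _ ≤ (Wp ρ μ μI) ^ (1 / ρ) + (Wp ρ μI η) ^ (1 / ρ) := by gcongr
    _ ≤ (Wp ρ μ μI) ^ (1 / ρ) + ((Wp ρ μ μI) ^ (1 / ρ) +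
          ((∫⁻ p, ‖p.1 - p.2‖ₑ ^ ρ ∂π) ^ (1 / ρ) + ε)) := by
        gcongr
        exact t2.trans (by gcongr)
    _ = _ := by ring
end
end

section
/- Let ρ > 1 and μ, ν ∈ P_ρ(ℝ^d). Then the infimum of W_ρ(ν,η)^ρ over all probability measures η on ℝ^d with μ ≤cx η is attained by some probability measure ν^ρ_{P̄(μ)} ∈ P_ρ(ℝ^d). -/
open MeasureTheory ProbabilityTheory Set
open scoped ENNReal

noncomputable section

open Filter Topology
open scoped NNReal BoundedContinuousFunction

namespace Stmt11Aux

/-- Reduction of the convex order to convex functions of linear growth. -/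
lemma convexOrder_of_linear_growth {E : Type*} [NormedAddCommGroup E] [NormedSpace ℝ E]
    [FiniteDimensional ℝ E] [MeasurableSpace E] [BorelSpace E]
    (μ η : Measure E) [IsProbabilityMeasure μ] [IsProbabilityMeasure η]
    (h : ∀ φ : E → ℝ, ConvexOn ℝ univ φ → Continuous φ → (∀ x, 0 ≤ φ x) →
      (∃ a b : ℝ, 0 ≤ a ∧ 0 ≤ b ∧ ∀ x, φ x ≤ a + b * ‖x‖) →
      ∫⁻ x, ENNReal.ofReal (φ x) ∂μ ≤ ∫⁻ x, ENNReal.ofReal (φ x) ∂η) :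
    ConvexOrder μ η := by
  have hcont : ∀ φ : E → ℝ, ConvexOn ℝ univ φ → Continuous φ := fun φ hφ =>
    continuousOn_univ.1 (hφ.continuousOn isOpen_univ)
  have : ProperSpace E := FiniteDimensional.proper ℝ E
  have h1 : ∀ φ : E → ℝ, ConvexOn ℝ univ φ → (∀ x, 0 ≤ φ x) →
      ∫⁻ x, ENNReal.ofReal (φ x) ∂μ ≤ ∫⁻ x, ENNReal.ofReal (φ x) ∂η := by
    intro φ hφ hpos
    have hc := hcont φ hφ
    obtain ⟨l, c, hle, hsup⟩ := hφ.real_univ_sSup_of_nat_affine_eq hc.lowerSemicontinuous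
    let ψ : ℕ → E → ℝ := fun k => Nat.rec (fun _ => 0) (fun i f x => max (f x) (l i x + c i)) k
    have ψ0 : ∀ x, ψ 0 x = 0 := fun x => rfl
    have ψs : ∀ k x, ψ (k+1) x = max (ψ k x) (l k x + c k) := fun k x => rfl
    have hψc : ∀ k, ConvexOn ℝ univ (ψ k) := by
      intro k
      induction k with
      | zero => exact convexOn_const 0 convex_univ
      | succ k ih =>
        have : ConvexOn ℝ univ (fun x => l k x + c k) :=
          ((l k).toLinearMap.convexOn convex_univ).add_const (c k)
        exact ih.sup this
    have hψpos : ∀ k x, 0 ≤ ψ k x := by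
      intro k x
      induction k with
      | zero => exact le_rfl
      | succ k ih => rw [ψs]; exact le_max_of_le_left ih
    have hψle : ∀ k x, ψ k x ≤ φ x := by
      intro k x
      induction k with
      | zero => exact hpos x
      | succ k ih => rw [ψs]; exact max_le ih (hle k x)
    have hψmono : ∀ x, Monotone (fun k => ψ k x) := fun x =>
      monotone_nat_of_le_succ fun k => by simp only [ψs]; exact le_max_left _ _
    have hψg : ∀ k, ∃ a b : ℝ, 0 ≤ a ∧ 0 ≤ b ∧ ∀ x, ψ k x ≤ a + b * ‖x‖ := by
      intro k
      induction k with
      | zero => exact ⟨0, 0, le_rfl, le_rfl, fun x => by simp [ψ0]⟩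
      | succ k ih =>
        obtain ⟨a, b, ha, hb, hab⟩ := ih
        refine ⟨a + |c k|, b + ‖l k‖, by positivity, by positivity, fun x => ?_⟩
        rw [ψs]
        have e1 := hab x
        have e2 : l k x ≤ ‖l k‖ * ‖x‖ := (le_abs_self _).trans ((l k).le_opNorm x)
        have e3 := le_abs_self (c k)
        have e4 : 0 ≤ ‖l k‖ * ‖x‖ := by positivity
        have e5 : 0 ≤ b * ‖x‖ := by positivity
        have e6 := abs_nonneg (c k)
        refine max_le ?_ ?_ <;> nlinarith
    have hsup' : ∀ x, ENNReal.ofReal (φ x) ≤ ⨆ k, ENNReal.ofReal (ψ k x) := by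
      intro x
      refine le_of_forall_lt fun r hr => ?_
      have hrt : r ≠ ∞ := ne_top_of_lt hr
      have hr' : r.toReal < φ x := by
        have := (ENNReal.lt_ofReal_iff_toReal_lt hrt).1 hr
        exact this
      have hx : ⨆ i, (l i x + c i) = φ x := by
        have h := congrFun hsup x
        rw [iSup_apply] at h
        exact h
      rw [← hx] at hr'
      obtain ⟨i, hi⟩ := exists_lt_of_lt_ciSup hr'
      refine lt_of_lt_of_le ?_ (le_iSup _ (i+1))
      rw [ENNReal.lt_ofReal_iff_toReal_lt hrt, ψs]
      exact lt_max_of_lt_right hi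
    calc ∫⁻ x, ENNReal.ofReal (φ x) ∂μ ≤ ∫⁻ x, ⨆ k, ENNReal.ofReal (ψ k x) ∂μ :=
          lintegral_mono hsup'
      _ = ⨆ k, ∫⁻ x, ENNReal.ofReal (ψ k x) ∂μ := by
          refine lintegral_iSup (fun k => ?_) ?_
          · exact ((hcont _ (hψc k)).measurable).ennreal_ofReal
          · intro i j hij x
            exact ENNReal.ofReal_le_ofReal (hψmono x hij)
      _ ≤ ∫⁻ x, ENNReal.ofReal (φ x) ∂η := by
          refine iSup_le fun k => ?_
          refine (h _ (hψc k) (hcont _ (hψc k)) (hψpos k) (hψg k)).trans ?_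
          exact lintegral_mono fun x => ENNReal.ofReal_le_ofReal (hψle k x)
  refine ⟨h1, ?_⟩
  intro φ hφ hint
  have hiμ : Integrable φ μ := hint.left_of_add_measure
  have hiη : Integrable φ η := hint.right_of_add_measure
  have hc := hcont φ hφ
  have hbd : ∀ (k : ℕ) x, ‖max (φ x) (-(k:ℝ))‖ ≤ ‖φ x‖ := by
    intro k x
    rw [Real.norm_eq_abs, Real.norm_eq_abs]
    have hk : (0:ℝ) ≤ k := Nat.cast_nonneg k
    rcases le_total (φ x) (-(k:ℝ)) with h | h
    · rw [max_eq_right h, abs_of_nonpos (by linarith), abs_of_nonpos (by linarith)]; linarith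
    · rw [max_eq_left h]
  have hck : ∀ k : ℕ, Continuous (fun x => max (φ x) (-(k:ℝ))) := fun k => by fun_prop
  have hlim : ∀ m : Measure E, Integrable φ m →
      Tendsto (fun k : ℕ => ∫ x, max (φ x) (-(k:ℝ)) ∂m) atTop (𝓝 (∫ x, φ x ∂m)) := by
    intro m hm
    refine tendsto_integral_of_dominated_convergence (fun x => ‖φ x‖)
      (fun k => (hck k).aestronglyMeasurable) hm.norm
      (fun k => Eventually.of_forall (hbd k)) (Eventually.of_forall fun x => ?_)
    refine tendsto_const_nhds.congr' ?_
    obtain ⟨N, hN⟩ := exists_nat_ge (-(φ x))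
    filter_upwards [eventually_ge_atTop N] with k hk
    have : (N:ℝ) ≤ k := by exact_mod_cast hk
    rw [max_eq_left]; linarith
  refine le_of_tendsto_of_tendsto' (hlim μ hiμ) (hlim η hiη) fun k => ?_
  have hik : ∀ m : Measure E, Integrable φ m → Integrable (fun x => max (φ x) (-(k:ℝ))) m :=
    fun m hm => hm.mono (hck k).aestronglyMeasurable (Eventually.of_forall (hbd k))
  have hpos : ∀ x, 0 ≤ max (φ x) (-(k:ℝ)) + k := fun x => by
    have := le_max_right (φ x) (-(k:ℝ)); linarith
  have hcvx : ConvexOn ℝ univ (fun x => max (φ x) (-(k:ℝ)) + k) :=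
    (hφ.sup (convexOn_const (-(k:ℝ)) convex_univ)).add_const (k:ℝ)
  have h2 := h1 _ hcvx hpos
  have hi1 := (hik μ hiμ).add (integrable_const (k:ℝ))
  have hi2 := (hik η hiη).add (integrable_const (k:ℝ))
  have e1 := ofReal_integral_eq_lintegral_ofReal hi1 (Eventually.of_forall hpos)
  have e2 := ofReal_integral_eq_lintegral_ofReal hi2 (Eventually.of_forall hpos)
  have h3 : ENNReal.ofReal (∫ x, (max (φ x) (-(k:ℝ)) + k) ∂μ)
      ≤ ENNReal.ofReal (∫ x, (max (φ x) (-(k:ℝ)) + k) ∂η) := by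
    refine (e1.trans_le ?_).trans e2.symm.le
    exact h2
  rw [ENNReal.ofReal_le_ofReal_iff (integral_nonneg hpos),
    integral_add (hik μ hiμ) (integrable_const _), integral_add (hik η hiη) (integrable_const _)] at h3
  simpa using h3

lemma add_rpow_bound {ρ s t : ℝ} (hρ : 0 ≤ ρ) (hs : 0 ≤ s) (ht : 0 ≤ t) :
    (s + t) ^ ρ ≤ 2 ^ ρ * s ^ ρ + 2 ^ ρ * t ^ ρ := by
  rw [← Real.mul_rpow (by norm_num) hs, ← Real.mul_rpow (by norm_num) ht]
  have h1 : 0 ≤ (2 * s) ^ ρ := by positivity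
  have h2 : 0 ≤ (2 * t) ^ ρ := by positivity
  rcases le_total s t with h | h
  · have := Real.rpow_le_rpow (by positivity) (show s + t ≤ 2 * t by linarith) hρ
    linarith
  · have := Real.rpow_le_rpow (by positivity) (show s + t ≤ 2 * s by linarith) hρ
    linarith

/-- integrated version -/
lemma lintegral_add_rpow_bound {Ω : Type*} [MeasurableSpace Ω] (π : Measure Ω) {ρ : ℝ}
    (hρ : 0 ≤ ρ) {f g h : Ω → ℝ} (hf : ∀ x, 0 ≤ f x) (hg : ∀ x, 0 ≤ g x) (hh : ∀ x, 0 ≤ h x)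
    (hgm : Measurable g) (hhm : Measurable h)
    (hfg : ∀ x, f x ≤ g x + h x) :
    ∫⁻ x, ENNReal.ofReal (f x ^ ρ) ∂π ≤
      ENNReal.ofReal (2 ^ ρ) * ∫⁻ x, ENNReal.ofReal (g x ^ ρ) ∂π
      + ENNReal.ofReal (2 ^ ρ) * ∫⁻ x, ENNReal.ofReal (h x ^ ρ) ∂π := by
  have mg : Measurable (fun x => ENNReal.ofReal (g x ^ ρ)) := (hgm.pow_const ρ).ennreal_ofReal
  have mh : Measurable (fun x => ENNReal.ofReal (h x ^ ρ)) := (hhm.pow_const ρ).ennreal_ofReal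
  rw [← lintegral_const_mul _ mg, ← lintegral_const_mul _ mh,
    ← lintegral_add_left (mg.const_mul _)]
  refine lintegral_mono fun x => ?_
  have a1 := Real.rpow_nonneg (hg x) ρ
  have a2 := Real.rpow_nonneg (hh x) ρ
  rw [← ENNReal.ofReal_mul (by positivity), ← ENNReal.ofReal_mul (by positivity),
    ← ENNReal.ofReal_add (by positivity) (by positivity)]
  exact ENNReal.ofReal_le_ofReal ((Real.rpow_le_rpow (hf x) (hfg x) hρ).trans
    (add_rpow_bound hρ (hg x) (hh x)))

/-- Passing to the limit for functions with linear growth. -/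
lemma le_lintegral_of_tendsto {E : Type*} [NormedAddCommGroup E]
    [MeasurableSpace E] [BorelSpace E] {ρ : ℝ} (hρ : 1 < ρ)
    (ηs : ℕ → ProbabilityMeasure E) (η : ProbabilityMeasure E)
    (hlim : Tendsto ηs atTop (𝓝 η)) (C : ℝ≥0∞) (hC : C ≠ ∞)
    (hmom : ∀ n, ∫⁻ x, ENNReal.ofReal (‖x‖ ^ ρ) ∂(ηs n : Measure E) ≤ C)
    (φ : E → ℝ) (hc : Continuous φ) (hpos : ∀ x, 0 ≤ φ x)
    (hg : ∃ a b : ℝ, 0 ≤ a ∧ 0 ≤ b ∧ ∀ x, φ x ≤ a + b * ‖x‖)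
    (L : ℝ≥0∞) (hL : ∀ n, L ≤ ∫⁻ x, ENNReal.ofReal (φ x) ∂(ηs n : Measure E)) :
    L ≤ ∫⁻ x, ENNReal.ofReal (φ x) ∂(η : Measure E) := by
  obtain ⟨a, b, ha, hb, hab⟩ := hg
  have hρ0 : 0 ≤ ρ := by linarith
  set D : ℝ≥0∞ := ENNReal.ofReal (2 ^ ρ) * ENNReal.ofReal (a ^ ρ)
      + ENNReal.ofReal (2 ^ ρ) * (ENNReal.ofReal (b ^ ρ) * C) with hD
  have hDt : D ≠ ∞ := by
    simp only [hD]
    exact ENNReal.add_ne_top.2 ⟨ENNReal.mul_ne_top ENNReal.ofReal_ne_top ENNReal.ofReal_ne_top,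
      ENNReal.mul_ne_top ENNReal.ofReal_ne_top (ENNReal.mul_ne_top ENNReal.ofReal_ne_top hC)⟩
  have hφρ : ∀ n, ∫⁻ x, ENNReal.ofReal (φ x ^ ρ) ∂(ηs n : Measure E) ≤ D := by
    intro n
    refine (lintegral_add_rpow_bound (ηs n : Measure E) hρ0 (g := fun _ => a)
      (h := fun x => b * ‖x‖) hpos (fun _ => ha) (fun x => by positivity)
      measurable_const (by fun_prop) hab).trans ?_
    simp only [hD]
    gcongr
    · simp
    · have : ∀ x : E, ENNReal.ofReal ((b * ‖x‖) ^ ρ)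
          = ENNReal.ofReal (b ^ ρ) * ENNReal.ofReal (‖x‖ ^ ρ) := fun x => by
        rw [Real.mul_rpow hb (norm_nonneg x), ENNReal.ofReal_mul (by positivity)]
      simp_rw [this]
      rw [lintegral_const_mul _ (by fun_prop)]
      gcongr
      exact hmom n
  have key : ∀ M : ℝ, 0 < M → L ≤ ∫⁻ x, ENNReal.ofReal (φ x) ∂(η : Measure E)
      + ENNReal.ofReal (M ^ (1 - ρ)) * D := by
    intro M hM
    let g : E →ᵇ ℝ≥0 := BoundedContinuousFunction.mkOfBound
      ⟨fun x => Real.toNNReal (min (φ x) M), by fun_prop⟩ M (by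
        intro x y
        have h1 : ∀ z, 0 ≤ min (φ z) M := fun z => le_min (hpos z) hM.le
        simp only [ContinuousMap.coe_mk, NNReal.dist_eq, Real.coe_toNNReal _ (h1 _)]
        have h2 : ∀ z, min (φ z) M ≤ M := fun z => min_le_right _ _
        rw [abs_le]
        constructor <;> linarith [h1 x, h1 y, h2 x, h2 y])
    have ht := (ProbabilityMeasure.tendsto_iff_forall_lintegral_tendsto.1 hlim) g
    have hgφ : ∀ x, ((g x : ℝ≥0) : ℝ≥0∞) = ENNReal.ofReal (min (φ x) M) := fun x => rfl
    simp_rw [hgφ] at ht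
    have h1 : ∀ n, L ≤ ∫⁻ x, ENNReal.ofReal (min (φ x) M) ∂(ηs n : Measure E)
        + ENNReal.ofReal (M ^ (1 - ρ)) * D := by
      intro n
      refine (hL n).trans ?_
      have : ∀ x, ENNReal.ofReal (φ x) ≤ ENNReal.ofReal (min (φ x) M)
          + ENNReal.ofReal (M ^ (1 - ρ)) * ENNReal.ofReal (φ x ^ ρ) := by
        intro x
        have hp := Real.rpow_nonneg (hpos x) ρ
        rcases le_total (φ x) M with h | h
        · rw [min_eq_left h]; exact le_self_add
        · refine le_add_left ?_
          rw [← ENNReal.ofReal_mul (by positivity)]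
          refine ENNReal.ofReal_le_ofReal ?_
          have hφ : 0 < φ x := hM.trans_le h
          have e : φ x = φ x ^ (1 - ρ) * φ x ^ ρ := by
            rw [← Real.rpow_add hφ]; simp
          conv_lhs => rw [e]
          exact mul_le_mul_of_nonneg_right
            (Real.rpow_le_rpow_of_nonpos hM h (by linarith)) hp
      refine (lintegral_mono this).trans ?_
      rw [lintegral_add_left (by fun_prop), lintegral_const_mul _
        ((hc.measurable.pow_const ρ).ennreal_ofReal)]
      gcongr
      exact hφρ n
    have h2 : L ≤ ∫⁻ x, ENNReal.ofReal (min (φ x) M) ∂(η : Measure E)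
        + ENNReal.ofReal (M ^ (1 - ρ)) * D :=
      ge_of_tendsto' (ht.add tendsto_const_nhds) h1
    refine h2.trans ?_
    gcongr
    exact min_le_left _ _
  have hz : Tendsto (fun M : ℝ => ∫⁻ x, ENNReal.ofReal (φ x) ∂(η : Measure E)
      + ENNReal.ofReal (M ^ (1 - ρ)) * D) atTop
      (𝓝 (∫⁻ x, ENNReal.ofReal (φ x) ∂(η : Measure E) + ENNReal.ofReal 0 * D)) := by
    refine tendsto_const_nhds.add (ENNReal.Tendsto.mul_const ?_ (Or.inr hDt))
    refine ENNReal.tendsto_ofReal ?_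
    have := tendsto_rpow_neg_atTop (y := ρ - 1) (by linarith)
    simpa using this
  have := ge_of_tendsto hz (by
    filter_upwards [eventually_gt_atTop (0:ℝ)] with M hM using key M hM)
  simpa using this

/-- Tightness from moments. -/
lemma tight_of_moment {F : Type*} [NormedAddCommGroup F] [ProperSpace F]
    [MeasurableSpace F] [BorelSpace F] {ρ : ℝ} (hρ : 0 < ρ) (C : ℝ≥0∞) (hC : C ≠ ∞)
    (S : Set (Measure F)) (hS : ∀ m ∈ S, ∫⁻ x, ENNReal.ofReal (‖x‖ ^ ρ) ∂m ≤ C) :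
    IsTightMeasureSet S := by
  refine isTightMeasureSet_of_tendsto_measure_norm_gt ?_
  have hz : Tendsto (fun r : ℝ => C / ENNReal.ofReal (r ^ ρ)) atTop (𝓝 0) := by
    have h : Tendsto (fun r : ℝ => ENNReal.ofReal (r ^ ρ)) atTop (𝓝 ∞) :=
      ENNReal.tendsto_ofReal_atTop.comp (tendsto_rpow_atTop hρ)
    have := ENNReal.Tendsto.const_div h (a := C) (Or.inr hC)
    simpa using this
  refine tendsto_of_tendsto_of_tendsto_of_le_of_le' tendsto_const_nhds hz
    (Eventually.of_forall fun _ => zero_le) ?_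
  filter_upwards [eventually_gt_atTop (0:ℝ)] with r hr
  refine iSup₂_le fun m hm => ?_
  have hr' : 0 < r ^ ρ := by positivity
  rw [ENNReal.le_div_iff_mul_le (Or.inl (by simpa using hr')) (Or.inl ENNReal.ofReal_ne_top), mul_comm]
  refine le_trans ?_ (hS m hm)
  refine le_trans ?_ (mul_meas_ge_le_lintegral₀ (μ := m)
    (f := fun x => ENNReal.ofReal (‖x‖ ^ ρ)) (by fun_prop) (ENNReal.ofReal (r ^ ρ)))
  refine mul_le_mul_right (measure_mono fun x hx => ?_) _
  exact ENNReal.ofReal_le_ofReal (Real.rpow_le_rpow hr.le (le_of_lt hx) hρ.le)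


theorem main {E : Type*} [NormedAddCommGroup E] [NormedSpace ℝ E]
    [FiniteDimensional ℝ E] [MeasurableSpace E] [BorelSpace E] (ρ : ℝ) (hρ : 1 < ρ)
    (μ ν : Measure E)
    [IsProbabilityMeasure μ] [IsProbabilityMeasure ν]
    (hμρ : Integrable (fun x => ‖x‖ ^ ρ) μ) (hνρ : Integrable (fun x => ‖x‖ ^ ρ) ν) :
    ∃ η : Measure E, IsProbabilityMeasure η
      ∧ ConvexOrder μ η
      ∧ Integrable (fun x => ‖x‖ ^ ρ) η
      ∧ Wp ρ ν η = ⨅ (η' : Measure E)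
          (_ : IsProbabilityMeasure η') (_ : ConvexOrder μ η'), Wp ρ ν η' := by
  have : ProperSpace E := FiniteDimensional.proper ℝ E
  have hρ0 : 0 ≤ ρ := by linarith
  set I := ⨅ (η' : Measure E) (_ : IsProbabilityMeasure η') (_ : ConvexOrder μ η'), Wp ρ ν η'
    with hI
  have hfin : ∀ m : Measure E, Integrable (fun x => ‖x‖ ^ ρ) m →
      ∫⁻ x, ENNReal.ofReal (‖x‖ ^ ρ) ∂m ≠ ∞ := fun m hm => hm.lintegral_lt_top.ne
  have hm : Measurable (fun x : E => ENNReal.ofReal (‖x‖ ^ ρ)) := by fun_prop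
  set A : ℝ≥0∞ := ENNReal.ofReal (2 ^ ρ) with hA
  have hAt : A ≠ ∞ := ENNReal.ofReal_ne_top
  set Nν := ∫⁻ x, ENNReal.ofReal (‖x‖ ^ ρ) ∂ν with hNν
  have hNνt : Nν ≠ ∞ := hfin ν hνρ
  -- finiteness of the infimum
  have hIfin : I ≠ ∞ := by
    have hcx : ConvexOrder μ μ := ⟨fun _ _ _ => le_rfl, fun _ _ _ => le_rfl⟩
    have h1 : I ≤ Wp ρ ν μ := iInf_le_of_le μ (iInf_le_of_le inferInstance (iInf_le _ hcx))
    have h2 : Wp ρ ν μ ≤ ∫⁻ p, ENNReal.ofReal (‖p.1 - p.2‖ ^ ρ) ∂(ν.prod μ) :=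
      iInf_le_of_le (ν.prod μ) (iInf_le_of_le (by simp) (iInf_le _ (by simp)))
    have h3 := Stmt11Aux.lintegral_add_rpow_bound (ν.prod μ) hρ0
      (f := fun p => ‖p.1 - p.2‖) (g := fun p => ‖p.1‖) (h := fun p => ‖p.2‖)
      (fun _ => norm_nonneg _) (fun _ => norm_nonneg _) (fun _ => norm_nonneg _)
      (by fun_prop) (by fun_prop) (fun p => norm_sub_le _ _)
    have e1 : ∫⁻ p, ENNReal.ofReal (‖p.1‖ ^ ρ) ∂(ν.prod μ) = Nν := by
      rw [hNν, ← lintegral_map (μ := ν.prod μ) hm measurable_fst]; simp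
    have e2 : ∫⁻ p, ENNReal.ofReal (‖p.2‖ ^ ρ) ∂(ν.prod μ)
        = ∫⁻ x, ENNReal.ofReal (‖x‖ ^ ρ) ∂μ := by
      rw [← lintegral_map (μ := ν.prod μ) hm measurable_snd]; simp
    rw [e1, e2] at h3
    exact ne_top_of_le_ne_top (ENNReal.add_ne_top.2 ⟨ENNReal.mul_ne_top hAt hNνt,
      ENNReal.mul_ne_top hAt (hfin μ hμρ)⟩) (h1.trans (h2.trans h3))
  -- minimizing sequence
  have hseq : ∀ n : ℕ, ∃ π : ProbabilityMeasure (E × E),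
      (π : Measure (E × E)).map Prod.fst = ν ∧
      ConvexOrder μ ((π : Measure (E × E)).map Prod.snd) ∧
      ∫⁻ p, ENNReal.ofReal (‖p.1 - p.2‖ ^ ρ) ∂(π : Measure (E × E)) ≤ I + ((n:ℝ≥0∞) + 1)⁻¹ := by
    intro n
    have hlt : I < I + ((n:ℝ≥0∞) + 1)⁻¹ := ENNReal.lt_add_right hIfin (by simp)
    obtain ⟨η', h1⟩ := iInf_lt_iff.1 hlt
    obtain ⟨hp, h2⟩ := iInf_lt_iff.1 h1
    obtain ⟨hcx, h3⟩ := iInf_lt_iff.1 h2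
    obtain ⟨π, h4⟩ := iInf_lt_iff.1 h3
    obtain ⟨hf, h5⟩ := iInf_lt_iff.1 h4
    obtain ⟨hs, h6⟩ := iInf_lt_iff.1 h5
    have hπ : IsProbabilityMeasure π := by
      constructor
      have : (π.map Prod.fst) univ = 1 := by rw [hf]; simp
      rwa [Measure.map_apply measurable_fst MeasurableSet.univ, preimage_univ] at this
    exact ⟨⟨π, hπ⟩, hf, by rw [ProbabilityMeasure.coe_mk, hs]; exact hcx, h6.le⟩
  choose π hπf hπc hπI using hseq
  have hnle : ∀ n : ℕ, ((n:ℝ≥0∞) + 1)⁻¹ ≤ 1 := fun n => by simp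
  -- moments
  have hfst : ∀ q : ProbabilityMeasure (E × E), (q : Measure (E × E)).map Prod.fst = ν →
      ∫⁻ p, ENNReal.ofReal (‖p.1‖ ^ ρ) ∂(q : Measure (E × E)) = Nν := by
    intro q hq
    rw [hNν, ← hq, lintegral_map hm measurable_fst]
  have hsnd : ∀ q : ProbabilityMeasure (E × E), (q : Measure (E × E)).map Prod.fst = ν →
      ∀ K, ∫⁻ p, ENNReal.ofReal (‖p.1 - p.2‖ ^ ρ) ∂(q : Measure (E × E)) ≤ K →
      ∫⁻ p, ENNReal.ofReal (‖p.2‖ ^ ρ) ∂(q : Measure (E × E)) ≤ A * Nν + A * K := by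
    intro q hq K hK
    have h3 := Stmt11Aux.lintegral_add_rpow_bound (q : Measure (E × E)) hρ0
      (f := fun p => ‖p.2‖) (g := fun p => ‖p.1‖) (h := fun p => ‖p.1 - p.2‖)
      (fun _ => norm_nonneg _) (fun _ => norm_nonneg _) (fun _ => norm_nonneg _)
      (by fun_prop) (by fun_prop) (fun p => by
        have := norm_sub_le p.1 (p.1 - p.2)
        simpa using this)
    rw [hfst q hq] at h3
    refine h3.trans ?_
    gcongr
  set C : ℝ≥0∞ := A * Nν + A * (I + 1) with hCdef
  have hCt : C ≠ ∞ := ENNReal.add_ne_top.2 ⟨ENNReal.mul_ne_top hAt hNνt,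
      ENNReal.mul_ne_top hAt (ENNReal.add_ne_top.2 ⟨hIfin, ENNReal.one_ne_top⟩)⟩
  have hπs : ∀ n, ∫⁻ p, ENNReal.ofReal (‖p.2‖ ^ ρ) ∂(π n : Measure (E × E)) ≤ C := fun n =>
    hsnd (π n) (hπf n) _ ((hπI n).trans (by gcongr; exact hnle n))
  -- compactness
  have htight : IsTightMeasureSet
      {((q : ProbabilityMeasure (E × E)) : Measure (E × E)) | q ∈ Set.range π} := by
    refine Stmt11Aux.tight_of_moment (ρ := ρ) (by linarith) (A * Nν + A * C)
      (ENNReal.add_ne_top.2 ⟨ENNReal.mul_ne_top hAt hNνt, ENNReal.mul_ne_top hAt hCt⟩) _ ?_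
    rintro m ⟨q, ⟨n, rfl⟩, rfl⟩
    have h3 := Stmt11Aux.lintegral_add_rpow_bound (π n : Measure (E × E)) hρ0
      (f := fun p => ‖p‖) (g := fun p => ‖p.1‖) (h := fun p => ‖p.2‖)
      (fun _ => norm_nonneg _) (fun _ => norm_nonneg _) (fun _ => norm_nonneg _)
      (by fun_prop) (by fun_prop) (fun p => by
        rw [Prod.norm_def]
        exact max_le_add_of_nonneg (norm_nonneg _) (norm_nonneg _))
    rw [hfst _ (hπf n)] at h3
    refine h3.trans ?_
    gcongr
    exact hπs n
  have hcomp := isCompact_closure_of_isTightMeasureSet htight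
  obtain ⟨q, -, s, hs, hlim⟩ := hcomp.isSeqCompact
    (fun n => subset_closure (Set.mem_range_self n) : ∀ n, π n ∈ closure (Set.range π))
  -- first marginal
  have hqf : (q : Measure (E × E)).map Prod.fst = ν := by
    have h1 : Tendsto (fun n => ((π ∘ s) n).map (f := Prod.fst) measurable_fst.aemeasurable) atTop
        (𝓝 (q.map (f := Prod.fst) measurable_fst.aemeasurable)) :=
      ProbabilityMeasure.tendsto_map_of_tendsto_of_continuous _ _ hlim continuous_fst
    have h2 : ∀ n, ((π ∘ s) n).map (f := Prod.fst) measurable_fst.aemeasurable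
        = (⟨ν, inferInstance⟩ : ProbabilityMeasure E) := fun n => Subtype.ext (hπf (s n))
    simp_rw [h2] at h1
    have h3 := tendsto_nhds_unique h1 tendsto_const_nhds
    exact congrArg Subtype.val h3
  -- second marginal
  let ηp : ProbabilityMeasure E := q.map (f := Prod.snd) measurable_snd.aemeasurable
  have hlim2 : Tendsto (fun n => ((π ∘ s) n).map (f := Prod.snd) measurable_snd.aemeasurable) atTop
      (𝓝 ηp) := ProbabilityMeasure.tendsto_map_of_tendsto_of_continuous _ _ hlim continuous_snd
  have hηp : (ηp : Measure E) = (q : Measure (E × E)).map Prod.snd := rfl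
  -- lower semicontinuity of the cost
  have hcost : ∫⁻ p, ENNReal.ofReal (‖p.1 - p.2‖ ^ ρ) ∂(q : Measure (E × E)) ≤ I := by
    have h1 := lintegral_le_liminf_lintegral_of_forall_isOpen_measure_le_liminf_measure
      (μ := (q : Measure (E × E))) (μs := fun n => ((π (s n) : ProbabilityMeasure (E × E)) : Measure (E × E)))
      (f := fun p => ‖p.1 - p.2‖ ^ ρ)
      ((continuous_norm.comp (continuous_fst.sub continuous_snd)).rpow_const (fun _ => Or.inr hρ0))
      (fun p => by positivity)
      (fun G hG => ProbabilityMeasure.le_liminf_measure_open_of_tendsto hlim hG)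
    have hz : Tendsto (fun n : ℕ => I + ((s n : ℝ≥0∞) + 1)⁻¹) atTop (𝓝 (I + 0)) := by
      refine tendsto_const_nhds.add ?_
      have h0 : Tendsto (fun n : ℕ => ((n : ℝ≥0∞) + 1)⁻¹) atTop (𝓝 0) := by
        have := (tendsto_add_atTop_iff_nat 1).2 ENNReal.tendsto_inv_nat_nhds_zero
        simpa using this
      exact h0.comp hs.tendsto_atTop
    rw [add_zero] at hz
    refine h1.trans ?_
    rw [← hz.liminf_eq]
    exact liminf_le_liminf (Eventually.of_forall fun n => hπI (s n))
  have hcx : ConvexOrder μ (ηp : Measure E) := by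
    refine Stmt11Aux.convexOrder_of_linear_growth _ _ ?_
    intro φ hφ hc hpos hg
    refine Stmt11Aux.le_lintegral_of_tendsto hρ _ ηp hlim2 C hCt ?_ φ hc hpos hg _ ?_
    · intro n
      refine le_trans (le_of_eq ?_) (hπs (s n))
      exact lintegral_map hm measurable_snd
    · intro n
      exact (hπc (s n)).1 φ hφ hpos
  refine ⟨(ηp : Measure E), inferInstance, hcx, ?_, le_antisymm ?_ ?_⟩
  · refine ⟨by fun_prop, ?_⟩
    rw [hasFiniteIntegral_iff_ofReal (Eventually.of_forall fun x => by positivity), hηp,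
      lintegral_map hm measurable_snd]
    refine lt_of_le_of_lt (hsnd q hqf I hcost) ?_
    exact (ENNReal.add_ne_top.2 ⟨ENNReal.mul_ne_top hAt hNνt,
      ENNReal.mul_ne_top hAt hIfin⟩).lt_top
  · exact (iInf_le_of_le (q : Measure (E × E)) (iInf_le_of_le hqf (iInf_le _ hηp.symm))).trans hcost
  · exact iInf_le_of_le _ (iInf_le_of_le inferInstance (iInf_le _ hcx))

end Stmt11Aux

/-- for `ρ > 1` and `μ, ν ∈ P_ρ(ℝ^d)`, the infimum of `W_ρ(ν,η)^ρ` over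
probability measures `η` with `μ ≤cx η` is attained by some `ν^ρ_{P̄(μ)} ∈ P_ρ(ℝ^d)`. -/
theorem stmt11 {d : ℕ} (ρ : ℝ) (hρ : 1 < ρ)
    (μ ν : Measure (EuclideanSpace ℝ (Fin d)))
    [IsProbabilityMeasure μ] [IsProbabilityMeasure ν]
    (hμρ : Integrable (fun x => ‖x‖ ^ ρ) μ) (hνρ : Integrable (fun x => ‖x‖ ^ ρ) ν) :
    ∃ η : Measure (EuclideanSpace ℝ (Fin d)), IsProbabilityMeasure η
      ∧ ConvexOrder μ η
      ∧ Integrable (fun x => ‖x‖ ^ ρ) η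
      ∧ Wp ρ ν η = ⨅ (η' : Measure (EuclideanSpace ℝ (Fin d)))
          (_ : IsProbabilityMeasure η') (_ : ConvexOrder μ η'), Wp ρ ν η' := by
  exact Stmt11Aux.main ρ hρ μ ν hμρ hνρ
end
end

section
/- Let ρ > 1 and μ, ν ∈ P_ρ(ℝ^d), and suppose either that ν is absolutely continuous with respect to the Lebesgue measure on ℝ^d, or that d = 1. Then there is a unique probability measure η with μ ≤cx η minimizing W_ρ(ν,η)^ρ over {η : μ ≤cx η}. -/
open MeasureTheory ProbabilityTheory Set
open scoped ENNReal

noncomputable section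

namespace CxProj

open Filter Topology

section General

set_option linter.unusedSectionVars false

variable {E : Type*} [NormedAddCommGroup E] [InnerProductSpace ℝ E] [FiniteDimensional ℝ E]
  [MeasurableSpace E] [BorelSpace E]

/-- The convex order tested on nonnegative convex functions only. -/
def CX (μ η : Measure E) : Prop :=
  ∀ φ : E → ℝ, ConvexOn ℝ univ φ → (∀ x, 0 ≤ φ x) →
      ∫⁻ x, ENNReal.ofReal (φ x) ∂μ ≤ ∫⁻ x, ENNReal.ofReal (φ x) ∂η

/-- Transport cost. -/
def cost (ρ : ℝ) (π : Measure (E × E)) : ℝ≥0∞ :=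
  ∫⁻ p, ENNReal.ofReal (‖p.1 - p.2‖ ^ ρ) ∂π

lemma convex_cont {φ : E → ℝ} (h : ConvexOn ℝ univ φ) : Continuous φ := by
  have := h.continuousOn_interior
  simpa [continuousOn_univ] using this

lemma CX.convexOrder {μ η : Measure E} [IsProbabilityMeasure μ] [IsProbabilityMeasure η]
    (h : CX μ η) : ConvexOrder μ η := by
  refine ⟨h, fun φ hφ hi => ?_⟩
  have hc := convex_cont hφ
  have hiμ : Integrable φ μ := hi.mono_measure (Measure.le_add_right le_rfl)
  have hiη : Integrable φ η := hi.mono_measure (Measure.le_add_left le_rfl)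
  have key : ∀ m : Measure E, IsProbabilityMeasure m → Integrable φ m →
      Tendsto (fun n : ℕ => ∫ x, max (φ x) (-(n:ℝ)) ∂m) atTop (𝓝 (∫ x, φ x ∂m)) := by
    intro m _ hm
    refine tendsto_integral_of_dominated_convergence (fun x => |φ x|) ?_ hm.abs ?_ ?_
    · intro n; exact (hc.max continuous_const).aestronglyMeasurable
    · intro n
      filter_upwards with x
      rw [Real.norm_eq_abs]
      have : (0:ℝ) ≤ n := Nat.cast_nonneg n
      rcases le_total (φ x) (-(n:ℝ)) with h1 | h1
      · rw [max_eq_right h1, abs_of_nonpos (by linarith), abs_of_nonpos (by linarith)]; linarith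
      · rw [max_eq_left h1]
    · filter_upwards with x
      refine tendsto_const_nhds.congr' ?_
      obtain ⟨N, hN⟩ := exists_nat_ge (-(φ x))
      filter_upwards [eventually_ge_atTop N] with n hn
      rw [max_eq_left]
      have : (N:ℝ) ≤ n := by exact_mod_cast hn
      linarith
  refine le_of_tendsto_of_tendsto' (key μ inferInstance hiμ) (key η inferInstance hiη) fun n => ?_
  have hcv : ConvexOn ℝ univ (fun x => max (φ x) (-(n:ℝ)) + n) :=
    (hφ.sup (convexOn_const _ convex_univ)).add_const _
  have hnn : ∀ x, 0 ≤ max (φ x) (-(n:ℝ)) + n := fun x => by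
    have := le_max_right (φ x) (-(n:ℝ)); linarith
  have h1 := h _ hcv hnn
  have int : ∀ m : Measure E, IsProbabilityMeasure m → Integrable φ m →
      Integrable (fun x => max (φ x) (-(n:ℝ)) + n) m := fun m _ hm =>
    (hm.sup (integrable_const _)).add (integrable_const _)
  have h2 : ∫ x, (max (φ x) (-(n:ℝ)) + n) ∂μ ≤ ∫ x, (max (φ x) (-(n:ℝ)) + n) ∂η := by
    rw [← ofReal_integral_eq_lintegral_ofReal (int μ inferInstance hiμ) (.of_forall hnn),
      ← ofReal_integral_eq_lintegral_ofReal (int η inferInstance hiη) (.of_forall hnn)] at h1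
    exact (ENNReal.ofReal_le_ofReal_iff (integral_nonneg hnn)).1 h1
  have iμ : Integrable (fun x => max (φ x) (-(n:ℝ))) μ := hiμ.sup (integrable_const _)
  have iη : Integrable (fun x => max (φ x) (-(n:ℝ))) η := hiη.sup (integrable_const _)
  rw [integral_add iμ (integrable_const _), integral_add iη (integrable_const _)] at h2
  simpa using h2

/-- It suffices to test on Lipschitz nonnegative convex functions. -/
lemma CX.of_lipschitz {μ η : Measure E}
    (h : ∀ φ : E → ℝ, ConvexOn ℝ univ φ → (∀ x, 0 ≤ φ x) → (∃ K, LipschitzWith K φ) →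
      ∫⁻ x, ENNReal.ofReal (φ x) ∂μ ≤ ∫⁻ x, ENNReal.ofReal (φ x) ∂η) : CX μ η := by
  intro φ hφ hnn
  have hc := convex_cont hφ
  obtain ⟨l, c, hle, hsup⟩ := hφ.real_univ_sSup_of_nat_affine_eq hc.lowerSemicontinuous
  -- partial maxima
  let ψ : ℕ → E → ℝ := fun n => Nat.rec (fun _ => 0) (fun k f x => max (f x) (l k x + c k)) n
  have ψ0 : ∀ x, ψ 0 x = 0 := fun x => rfl
  have ψs : ∀ n x, ψ (n+1) x = max (ψ n x) (l n x + c n) := fun n x => rfl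
  have hcv : ∀ n, ConvexOn ℝ univ (ψ n) := by
    intro n
    induction n with
    | zero => exact convexOn_const _ convex_univ
    | succ k ih =>
      exact ih.sup (((l k).toLinearMap.convexOn convex_univ).add_const _)
  have hmono : ∀ x, Monotone fun n => ψ n x := fun x =>
    monotone_nat_of_le_succ fun n => by rw [ψs]; exact le_max_left _ _
  have hnn' : ∀ n x, 0 ≤ ψ n x := fun n x => hmono x (Nat.zero_le n)
  have hlip : ∀ n, ∃ K, LipschitzWith K (ψ n) := by
    intro n
    induction n with
    | zero => exact ⟨0, LipschitzWith.const _⟩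
    | succ k ih =>
      obtain ⟨K, hK⟩ := ih
      have h2 : LipschitzWith ‖l k‖₊ (fun x => l k x + c k) := by
        simpa using (l k).lipschitz.add (LipschitzWith.const (c k))
      exact ⟨_, hK.max h2⟩
  have hle' : ∀ n x, ψ n x ≤ φ x := by
    intro n x
    induction n with
    | zero => exact hnn x
    | succ k ih => rw [ψs]; exact max_le ih (hle k x)
  have hs : ∀ x, ENNReal.ofReal (φ x) = ⨆ n, ENNReal.ofReal (ψ n x) := by
    intro x
    apply le_antisymm
    · refine le_of_forall_lt fun a ha => ?_
      obtain ⟨b, hb, rfl⟩ : ∃ b : ℝ, 0 ≤ b ∧ a = ENNReal.ofReal b :=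
        ⟨a.toReal, ENNReal.toReal_nonneg, (ENNReal.ofReal_toReal ha.ne_top).symm⟩
      have hb2 : b < φ x := (ENNReal.ofReal_lt_ofReal_iff_of_nonneg hb).1 ha
      have hx : (⨆ i, ((l i : E → ℝ) + Function.const E (c i))) x = φ x := by rw [hsup]
      rw [iSup_apply] at hx
      rw [← hx] at hb2
      obtain ⟨i, hi⟩ := exists_lt_of_lt_ciSup hb2
      have h3 : b < ψ (i+1) x := lt_of_lt_of_le hi (by rw [ψs]; exact le_max_right _ _)
      exact lt_of_lt_of_le ((ENNReal.ofReal_lt_ofReal_iff_of_nonneg hb).2 h3)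
        (le_iSup (fun n => ENNReal.ofReal (ψ n x)) (i+1))
    · exact iSup_le fun n => ENNReal.ofReal_le_ofReal (hle' n x)
  have hmeas : ∀ n, Measurable fun x => ENNReal.ofReal (ψ n x) := fun n =>
    (convex_cont (hcv n)).measurable.ennreal_ofReal
  have hmono' : Monotone fun n x => ENNReal.ofReal (ψ n x) := fun a b hab x =>
    ENNReal.ofReal_le_ofReal (hmono x hab)
  simp_rw [hs]
  rw [lintegral_iSup hmeas hmono', lintegral_iSup hmeas hmono']
  exact iSup_mono fun n => h _ (hcv n) (hnn' n) (hlip n)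

lemma lsc_lintegral {Ω : Type*} [MeasurableSpace Ω] [PseudoEMetricSpace Ω] [BorelSpace Ω]
    {P : ℕ → ProbabilityMeasure Ω} {Q : ProbabilityMeasure Ω}
    (h : Tendsto P atTop (𝓝 Q)) {f : Ω → ℝ} (hf : Continuous f) (hn : ∀ x, 0 ≤ f x) {C : ℝ≥0∞}
    (hC : ∃ᶠ n in atTop, ∫⁻ x, ENNReal.ofReal (f x) ∂(P n : Measure Ω) ≤ C) :
    ∫⁻ x, ENNReal.ofReal (f x) ∂(Q : Measure Ω) ≤ C := by
  refine (lintegral_le_liminf_lintegral_of_forall_isOpen_measure_le_liminf_measure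
    (μs := fun n => (P n : Measure Ω)) hf hn fun G hG =>
      ProbabilityMeasure.le_liminf_measure_open_of_tendsto h hG).trans ?_
  exact liminf_le_of_frequently_le' hC

lemma exists_bound {ρ : ℝ} (hρ : 1 < ρ) {K δ : ℝ} (hK : 0 ≤ K) (hδ : 0 < δ) :
    ∃ M : ℝ, 0 ≤ M ∧ ∀ t : ℝ, 0 ≤ t → K * t ≤ M + δ * t ^ ρ := by
  have h1 : 0 < ρ - 1 := by linarith
  set T := (K / δ) ^ (1 / (ρ - 1)) with hT
  have hT0 : 0 ≤ T := by positivity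
  refine ⟨K * T, by positivity, fun t ht => ?_⟩
  rcases le_total t T with h | h
  · have := mul_le_mul_of_nonneg_left h hK
    have : 0 ≤ δ * t ^ ρ := by positivity
    linarith
  · have h2 : K / δ ≤ t ^ (ρ - 1) := by
      calc K / δ = T ^ (ρ - 1) := by
            rw [hT, ← Real.rpow_mul (by positivity), one_div, inv_mul_cancel₀ h1.ne', Real.rpow_one]
        _ ≤ _ := Real.rpow_le_rpow hT0 h h1.le
    rw [div_le_iff₀ hδ] at h2
    have h3 : t ^ ρ = t ^ (ρ - 1) * t := by
      rcases ht.eq_or_lt with rfl | ht'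
      · rw [mul_zero, Real.zero_rpow (by linarith)]
      · rw [← Real.rpow_add_one ht'.ne']; ring_nf
    rw [h3]
    have := mul_le_mul_of_nonneg_right h2 ht
    have : 0 ≤ K * T := by positivity
    nlinarith

lemma CX.closed {ρ : ℝ} (hρ : 1 < ρ) {μ : Measure E}
    {P : ℕ → ProbabilityMeasure E} {Q : ProbabilityMeasure E} (h : Tendsto P atTop (𝓝 Q))
    {C : ℝ≥0∞} (hC : C ≠ ∞)
    (hm : ∀ n, ∫⁻ x, ENNReal.ofReal (‖x‖ ^ ρ) ∂(P n : Measure E) ≤ C)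
    (hP : ∀ n, CX μ (P n : Measure E)) : CX μ (Q : Measure E) := by
  apply CX.of_lipschitz
  rintro φ hφ hnn ⟨K, hK⟩
  have hρ0 : (0:ℝ) ≤ ρ := by linarith
  have hφc := convex_cont hφ
  have hpc : Continuous fun x : E => ‖x‖ ^ ρ := continuous_norm.rpow_const fun _ => Or.inr hρ0
  have main : ∀ δ : NNReal, 0 < δ → ∫⁻ x, ENNReal.ofReal (φ x) ∂μ ≤
      ∫⁻ x, ENNReal.ofReal (φ x) ∂(Q : Measure E) + δ * C := by
    intro δ hδ
    obtain ⟨M, hM0, hM⟩ := exists_bound hρ K.2 (show (0:ℝ) < δ from hδ)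
    set M' := M + φ 0
    have hM'0 : 0 ≤ M' := add_nonneg hM0 (hnn 0)
    have hb : ∀ x, φ x ≤ M' + δ * ‖x‖ ^ ρ := by
      intro x
      have h1 := hK.dist_le_mul x 0
      rw [Real.dist_eq, dist_zero_right] at h1
      have h2 := hM ‖x‖ (norm_nonneg x)
      have h3 := le_abs_self (φ x - φ 0)
      have h4 : (K:ℝ) * ‖x‖ ≤ M + δ * ‖x‖ ^ ρ := h2
      simp only [M']; linarith
    set f : E → ℝ := fun x => M' + δ * ‖x‖ ^ ρ - φ x
    have hf0 : ∀ x, 0 ≤ f x := fun x => sub_nonneg.2 (hb x)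
    have hfc : Continuous f := (continuous_const.add (continuous_const.mul hpc)).sub hφc
    have sum : ∀ m : Measure E, IsProbabilityMeasure m →
        ∫⁻ x, ENNReal.ofReal (f x) ∂m + ∫⁻ x, ENNReal.ofReal (φ x) ∂m
          = ENNReal.ofReal M' + δ * ∫⁻ x, ENNReal.ofReal (‖x‖ ^ ρ) ∂m := by
      intro m _
      rw [← lintegral_add_left hfc.measurable.ennreal_ofReal,
        ← lintegral_const_mul _ hpc.measurable.ennreal_ofReal]
      have : ENNReal.ofReal M' = ∫⁻ x, ENNReal.ofReal M' ∂m := by simp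
      rw [this, ← lintegral_add_left measurable_const]
      refine lintegral_congr fun x => ?_
      rw [← ENNReal.ofReal_add (hf0 x) (hnn x), ← ENNReal.ofReal_coe_nnreal,
        ← ENNReal.ofReal_mul δ.coe_nonneg, ← ENNReal.ofReal_add hM'0 (by positivity)]
      simp [f]
    set A := ∫⁻ x, ENNReal.ofReal (φ x) ∂μ
    have hn : ∀ n, ∫⁻ x, ENNReal.ofReal (f x) ∂(P n : Measure E) + A ≤ ENNReal.ofReal M' + δ * C := by
      intro n
      refine (add_le_add_right (hP n φ hφ hnn) _).trans ?_
      rw [sum _ inferInstance]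
      gcongr
      exact hm n
    have hfin : ENNReal.ofReal M' + δ * C ≠ ∞ := by finiteness
    have hA : A ≠ ∞ := ne_top_of_le_ne_top hfin (le_trans le_add_self (hn 0))
    have hQ : ∫⁻ x, ENNReal.ofReal (f x) ∂(Q : Measure E) ≤ ENNReal.ofReal M' + δ * C - A :=
      lsc_lintegral h hfc hf0 (Frequently.of_forall fun n =>
        ENNReal.le_sub_of_add_le_right hA (hn n))
    have hQ2 : ∫⁻ x, ENNReal.ofReal (f x) ∂(Q : Measure E) + A ≤ ENNReal.ofReal M' + δ * C := by
      refine (add_le_add_left hQ _).trans ?_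
      rw [tsub_add_cancel_of_le (le_trans le_add_self (hn 0))]
    have hQfin : ∫⁻ x, ENNReal.ofReal (f x) ∂(Q : Measure E) ≠ ∞ :=
      ne_top_of_le_ne_top hfin (le_trans le_self_add hQ2)
    have hs := sum Q inferInstance
    have : ENNReal.ofReal M' ≤
        ∫⁻ x, ENNReal.ofReal (f x) ∂(Q : Measure E) + ∫⁻ x, ENNReal.ofReal (φ x) ∂(Q : Measure E) := by
      rw [hs]; exact le_self_add
    have h5 := hQ2.trans (add_le_add_left this _)
    rw [add_assoc] at h5
    exact (ENNReal.add_le_add_iff_left hQfin).1 h5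
  refine ENNReal.le_of_forall_pos_le_add fun ε hε _ => ?_
  obtain ⟨δ, hδ0, hδ⟩ : ∃ δ : NNReal, 0 < δ ∧ (δ : ℝ≥0∞) * C ≤ ε := by
    lift C to NNReal using hC
    refine ⟨ε / (C + 1), by positivity, ?_⟩
    norm_cast
    rw [div_mul_eq_mul_div, div_le_iff₀ (by positivity)]
    gcongr
    exact le_self_add
  exact (main δ hδ0).trans (by gcongr)

end General
section Existence

set_option linter.unusedSectionVars false

variable {E : Type*} [NormedAddCommGroup E] [InnerProductSpace ℝ E] [FiniteDimensional ℝ E]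
  [MeasurableSpace E] [BorelSpace E]

lemma rpow_add_bound {ρ : ℝ} (hρ : 0 ≤ ρ) {a b c : ℝ} (ha : 0 ≤ a) (hb : 0 ≤ b) (hc : 0 ≤ c)
    (h : a ≤ b + c) : a ^ ρ ≤ 2 ^ ρ * (b ^ ρ + c ^ ρ) := by
  have hb' : 0 ≤ b ^ ρ := by positivity
  have hc' : 0 ≤ c ^ ρ := by positivity
  have h2 : (0:ℝ) ≤ 2 ^ ρ := by positivity
  rcases le_total b c with hbc | hbc
  · calc a ^ ρ ≤ (2 * c) ^ ρ := Real.rpow_le_rpow ha (by linarith) hρ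
      _ = 2 ^ ρ * c ^ ρ := Real.mul_rpow (by norm_num) hc
      _ ≤ _ := by gcongr; linarith
  · calc a ^ ρ ≤ (2 * b) ^ ρ := Real.rpow_le_rpow ha (by linarith) hρ
      _ = 2 ^ ρ * b ^ ρ := Real.mul_rpow (by norm_num) hb
      _ ≤ _ := by gcongr; linarith

lemma ofReal_bound {ρ : ℝ} (hρ : 0 ≤ ρ) {a b c : ℝ} (ha : 0 ≤ a) (hb : 0 ≤ b) (hc : 0 ≤ c)
    (h : a ≤ b + c) : ENNReal.ofReal (a ^ ρ) ≤
      ENNReal.ofReal (2 ^ ρ) * (ENNReal.ofReal (b ^ ρ) + ENNReal.ofReal (c ^ ρ)) := by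
  rw [← ENNReal.ofReal_add (by positivity) (by positivity), ← ENNReal.ofReal_mul (by positivity)]
  exact ENNReal.ofReal_le_ofReal (rpow_add_bound hρ ha hb hc h)

lemma meas_norm_rpow {Ω : Type*} [MeasurableSpace Ω] {f : Ω → E} (hf : Measurable f) (ρ : ℝ) :
    Measurable fun x => ENNReal.ofReal (‖f x‖ ^ ρ) :=
  (hf.norm.pow_const ρ).ennreal_ofReal

/-- ρ-moment -/
def mom (ρ : ℝ) (m : Measure E) : ℝ≥0∞ := ∫⁻ x, ENNReal.ofReal (‖x‖ ^ ρ) ∂m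

lemma mom_map {Ω : Type*} [MeasurableSpace Ω] {f : Ω → E} (hf : Measurable f) (ρ : ℝ)
    (π : Measure Ω) : mom ρ (π.map f) = ∫⁻ p, ENNReal.ofReal (‖f p‖ ^ ρ) ∂π :=
  lintegral_map (f := fun x : E => ENNReal.ofReal (‖x‖ ^ ρ)) (meas_norm_rpow measurable_id ρ) hf

lemma mom_snd_le {ρ : ℝ} (hρ : 0 ≤ ρ) (π : Measure (E × E)) :
    mom ρ (π.map Prod.snd) ≤ ENNReal.ofReal (2 ^ ρ) * (mom ρ (π.map Prod.fst) + cost ρ π) := by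
  unfold cost
  rw [mom_map measurable_snd, mom_map measurable_fst,
    ← lintegral_add_left (meas_norm_rpow measurable_fst ρ), ← lintegral_const_mul]
  · refine lintegral_mono fun p => ?_
    refine ofReal_bound hρ (norm_nonneg _) (norm_nonneg _) (norm_nonneg _) ?_
    calc ‖p.2‖ = ‖p.1 - (p.1 - p.2)‖ := by rw [sub_sub_cancel]
      _ ≤ _ := norm_sub_le _ _
  · exact (meas_norm_rpow measurable_fst ρ).add
      (meas_norm_rpow (measurable_fst.sub measurable_snd) ρ)

lemma tail_le {ρ : ℝ} (hρ : 0 < ρ) (m : Measure E) {r : ℝ} (hr : 0 < r) :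
    m {x | r < ‖x‖} ≤ mom ρ m / ENNReal.ofReal (r ^ ρ) := by
  have h0 : 0 < r ^ ρ := by positivity
  refine le_trans (measure_mono fun x hx => ?_)
    (meas_ge_le_lintegral_div (meas_norm_rpow measurable_id ρ).aemeasurable
      (by simpa using h0) ENNReal.ofReal_ne_top)
  exact ENNReal.ofReal_le_ofReal (Real.rpow_le_rpow hr.le (le_of_lt hx) hρ.le)

lemma tight_of_mom {ρ : ℝ} (hρ : 0 < ρ) {S : Set (Measure E)} {C : ℝ≥0∞} (hC : C ≠ ∞)
    (h : ∀ m ∈ S, mom ρ m ≤ C) : IsTightMeasureSet S := by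
  apply isTightMeasureSet_of_tendsto_measure_norm_gt
  have h1 : Tendsto (fun r : ℝ => C / ENNReal.ofReal (r ^ ρ)) atTop (𝓝 0) := by
    have : Tendsto (fun r : ℝ => ENNReal.ofReal (r ^ ρ)) atTop (𝓝 ∞) :=
      ENNReal.tendsto_ofReal_atTop.comp (tendsto_rpow_atTop hρ)
    have h2 := ENNReal.Tendsto.const_div (a := C) this (Or.inr hC)
    simpa using h2
  refine tendsto_of_tendsto_of_tendsto_of_le_of_le' tendsto_const_nhds h1
    (.of_forall fun _ => zero_le) ?_
  filter_upwards [eventually_gt_atTop 0] with r hr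
  refine iSup₂_le fun m hm => (tail_le hρ m hr).trans ?_
  gcongr
  exact h m hm

lemma exists_min {ρ : ℝ} (hρ : 1 < ρ) {ν : Measure E} (hν : mom ρ ν ≠ ∞)
    (S : Set (ProbabilityMeasure (E × E)))
    (hfst : ∀ π ∈ S, (π : Measure (E × E)).map Prod.fst = ν)
    (hcl : ∀ (P : ℕ → ProbabilityMeasure (E × E)) (Q : ProbabilityMeasure (E × E)) (C : ℝ≥0∞),
      (∀ n, P n ∈ S) → Tendsto P atTop (𝓝 Q) → C ≠ ∞ →
      (∀ n, mom ρ ((P n : Measure (E × E)).map Prod.snd) ≤ C) → Q ∈ S)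
    (hne : ∃ π ∈ S, cost ρ (π : Measure (E × E)) ≠ ∞) :
    ∃ π ∈ S, cost ρ (π : Measure (E × E)) ≠ ∞ ∧
      ∀ π' ∈ S, cost ρ (π : Measure (E × E)) ≤ cost ρ (π' : Measure (E × E)) := by
  have hρ0 : (0:ℝ) < ρ := by linarith
  obtain ⟨π₀, hπ₀, hfin⟩ := hne
  set V : ℝ≥0∞ := ⨅ π ∈ S, cost ρ (π : Measure (E × E)) with hV
  have hVfin : V ≠ ∞ := ne_top_of_le_ne_top hfin (iInf₂_le π₀ hπ₀)
  have hseq : ∀ n : ℕ, ∃ π ∈ S, cost ρ (π : Measure (E × E)) ≤ V + ((n:ℝ≥0∞) + 1)⁻¹ := by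
    intro n
    have : V < V + ((n:ℝ≥0∞) + 1)⁻¹ := ENNReal.lt_add_right hVfin (by simp)
    rw [hV] at this
    obtain ⟨π, hπ⟩ := iInf_lt_iff.1 this
    obtain ⟨hπS, hπ⟩ := iInf_lt_iff.1 hπ
    exact ⟨π, hπS, hπ.le⟩
  choose P hPS hP using hseq
  have hP1 : ∀ n, cost ρ (P n : Measure (E × E)) ≤ V + 1 := fun n => (hP n).trans (by
    gcongr; simp)
  set C : ℝ≥0∞ := ENNReal.ofReal (2 ^ ρ) * (mom ρ ν + (V + 1))
  have hC : C ≠ ∞ := by finiteness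
  have hmom : ∀ n, mom ρ ((P n : Measure (E × E)).map Prod.snd) ≤ C := fun n => by
    refine (mom_snd_le hρ0.le _).trans ?_
    rw [hfst _ (hPS n)]
    exact mul_le_mul_right (add_le_add_right (hP1 n) _) _
  have htight : IsTightMeasureSet {((π : ProbabilityMeasure (E × E)) : Measure (E × E)) | π ∈ range P} := by
    apply IsTightMeasureSet.prodMk
    · refine tight_of_mom hρ0 hν ?_
      rintro _ ⟨_, ⟨_, ⟨n, rfl⟩, rfl⟩, rfl⟩
      rw [Measure.fst, hfst _ (hPS n)]
    · refine tight_of_mom hρ0 hC ?_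
      rintro _ ⟨_, ⟨_, ⟨n, rfl⟩, rfl⟩, rfl⟩
      exact hmom n
  have hcomp := isCompact_closure_of_isTightMeasureSet htight
  obtain ⟨Q, -, s, hs, hlim⟩ := hcomp.tendsto_subseq (fun n => subset_closure (mem_range_self n))
  have hQS : Q ∈ S := hcl _ Q C (fun n => hPS (s n)) hlim hC (fun n => hmom (s n))
  have hQ : cost ρ (Q : Measure (E × E)) ≤ V := by
    refine ENNReal.le_of_forall_pos_le_add fun ε hε _ => ?_
    refine lsc_lintegral hlim (f := fun p : E × E => ‖p.1 - p.2‖ ^ ρ) ?_ (fun p => by positivity) ?_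
    · exact (continuous_fst.sub continuous_snd).norm.rpow_const fun _ => Or.inr hρ0.le
    · apply Eventually.frequently
      have h1 : Tendsto (fun n : ℕ => ((n:ℝ≥0∞) + 1)⁻¹) atTop (𝓝 0) := by
        have := (tendsto_add_atTop_iff_nat 1).2 ENNReal.tendsto_inv_nat_nhds_zero
        simpa using this
      have h2 := (h1.comp hs.tendsto_atTop).eventually
        (gt_mem_nhds (show (0:ℝ≥0∞) < ε by exact_mod_cast hε))
      filter_upwards [h2] with n hn
      exact (hP (s n)).trans (by gcongr; exact hn.le)
  exact ⟨Q, hQS, ne_top_of_le_ne_top hVfin hQ, fun π' hπ' => hQ.trans (iInf₂_le π' hπ')⟩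

lemma prob_of_map {Ω Ω' : Type*} [MeasurableSpace Ω] [MeasurableSpace Ω'] {π : Measure Ω}
    {f : Ω → Ω'} (hf : Measurable f) {ν : Measure Ω'} [IsProbabilityMeasure ν]
    (h : π.map f = ν) : IsProbabilityMeasure π := by
  constructor
  have : (π.map f) univ = 1 := by rw [h]; exact measure_univ
  rwa [Measure.map_apply hf MeasurableSet.univ, preimage_univ] at this

lemma marg_closed {P : ℕ → ProbabilityMeasure (E × E)} {Q : ProbabilityMeasure (E × E)}
    (h : Tendsto P atTop (𝓝 Q)) {f : E × E → E} (hf : Continuous f) {ν : Measure E}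
    (hP : ∀ n, (P n : Measure (E × E)).map f = ν) : (Q : Measure (E × E)).map f = ν := by
  have h1 := ProbabilityMeasure.tendsto_map_of_tendsto_of_continuous P Q h hf
  have h2 : ∀ n, (P n).map hf.measurable.aemeasurable = (P 0).map hf.measurable.aemeasurable := by
    intro n
    apply Subtype.ext
    exact (hP n).trans (hP 0).symm
  simp_rw [h2] at h1
  have h3 := tendsto_nhds_unique tendsto_const_nhds h1
  have h4 := congrArg (fun m : ProbabilityMeasure E => (m : Measure E)) h3
  exact h4.symm.trans (hP 0)

/-- Optimal couplings exist. -/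
lemma exists_opt_coupling {ρ : ℝ} (hρ : 1 < ρ) {ν η : Measure E} [IsProbabilityMeasure ν]
    (hν : mom ρ ν ≠ ∞) (hW : Wp ρ ν η ≠ ∞) :
    ∃ π : Measure (E × E), π.map Prod.fst = ν ∧ π.map Prod.snd = η ∧ cost ρ π = Wp ρ ν η := by
  obtain ⟨π, hπ, -, hmin⟩ := exists_min hρ hν
    {π | (π : Measure (E × E)).map Prod.fst = ν ∧ (π : Measure (E × E)).map Prod.snd = η}
    (fun π h => h.1)
    (fun P Q C hP hlim _ _ => ⟨marg_closed hlim continuous_fst fun n => (hP n).1,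
      marg_closed hlim continuous_snd fun n => (hP n).2⟩)
    (by
      have : Wp ρ ν η < ∞ := hW.lt_top
      unfold Wp at this
      obtain ⟨π, hπ⟩ := iInf_lt_iff.1 this
      obtain ⟨h1, hπ⟩ := iInf_lt_iff.1 hπ
      obtain ⟨h2, hπ⟩ := iInf_lt_iff.1 hπ
      exact ⟨⟨π, prob_of_map measurable_fst h1⟩, ⟨h1, h2⟩, hπ.ne⟩)
  refine ⟨π, hπ.1, hπ.2, le_antisymm ?_ ?_⟩
  · refine le_iInf fun π' => le_iInf fun h1 => le_iInf fun h2 => ?_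
    exact hmin ⟨π', prob_of_map measurable_fst h1⟩ ⟨h1, h2⟩
  · exact iInf_le_of_le _ (iInf_le_of_le hπ.1 (iInf_le_of_le hπ.2 le_rfl))

/-- Admissible plans. -/
def Adm (μ ν : Measure E) (π : Measure (E × E)) : Prop :=
  π.map Prod.fst = ν ∧ CX μ (π.map Prod.snd)

/-- Optimal admissible plans. -/
def Opt (ρ : ℝ) (μ ν : Measure E) (π : Measure (E × E)) : Prop :=
  Adm μ ν π ∧ cost ρ π ≠ ∞ ∧ ∀ π', Adm μ ν π' → cost ρ π ≤ cost ρ π'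

lemma exists_opt {ρ : ℝ} (hρ : 1 < ρ) {μ ν : Measure E} [IsProbabilityMeasure μ]
    [IsProbabilityMeasure ν] (hμ : mom ρ μ ≠ ∞) (hν : mom ρ ν ≠ ∞) :
    ∃ π, Opt ρ μ ν π := by
  have hρ0 : (0:ℝ) < ρ := by linarith
  obtain ⟨π, hπ, hfin, hmin⟩ := exists_min hρ hν
    {π | Adm μ ν (π : Measure (E × E))}
    (fun π h => h.1)
    (fun P Q C hP hlim hC hm => ⟨marg_closed hlim continuous_fst fun n => (hP n).1,
      CX.closed hρ (ProbabilityMeasure.tendsto_map_of_tendsto_of_continuous P Q hlim continuous_snd)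
        hC hm (fun n => (hP n).2)⟩)
    (by
      refine ⟨⟨ν.prod μ, inferInstance⟩, ⟨by simp, ?_⟩, ?_⟩
      · simp only [ProbabilityMeasure.coe_mk, Measure.map_snd_prod, measure_univ, one_smul]
        exact fun φ _ _ => le_rfl
      · have : cost ρ (ν.prod μ) ≤ ENNReal.ofReal (2 ^ ρ) * (mom ρ ν + mom ρ μ) := by
          have e1 : mom ρ ν = mom ρ ((ν.prod μ).map Prod.fst) := by simp
          have e2 : mom ρ μ = mom ρ ((ν.prod μ).map Prod.snd) := by simp
          rw [e1, e2]
          unfold cost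
          rw [mom_map measurable_snd, mom_map measurable_fst,
            ← lintegral_add_left (meas_norm_rpow measurable_fst ρ), ← lintegral_const_mul]
          · refine lintegral_mono fun p => ?_
            exact ofReal_bound hρ0.le (norm_nonneg _) (norm_nonneg _) (norm_nonneg _)
              (norm_sub_le _ _)
          · exact (meas_norm_rpow measurable_fst ρ).add (meas_norm_rpow measurable_snd ρ)
        exact ne_top_of_le_ne_top (by finiteness) this)
  exact ⟨π, hπ, hfin, fun π' h' => hmin ⟨π', prob_of_map measurable_fst h'.1⟩ h'⟩

end Existence
section TwoPoint

set_option linter.unusedSectionVars false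

variable {E : Type*} [NormedAddCommGroup E] [InnerProductSpace ℝ E] [FiniteDimensional ℝ E]
  [MeasurableSpace E] [BorelSpace E]

/-- First perturbed pair. -/
def pa (t : ℝ) (q : (E × E) × (E × E)) : E × E := (q.1.1, q.1.2 - t • (q.2.1 - q.1.1))

/-- Second perturbed pair. -/
def pb (q : (E × E) × (E × E)) : E × E := (q.1.1, q.2.2 - (q.2.1 - q.1.1))

lemma pa_meas (t : ℝ) : Measurable (pa (E := E) t) := by
  unfold pa; fun_prop

lemma pb_meas : Measurable (pb (E := E)) := by
  unfold pb; fun_prop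

/-- The perturbed plan. -/
def pert (π : Measure (E × E)) (t : ℝ) (A : Set ((E × E) × (E × E))) : Measure (E × E) :=
  ((π.prod π).restrict Aᶜ).map Prod.fst
  + (ENNReal.ofReal (1 / (1 + t)) • ((π.prod π).restrict A).map (pa t)
    + ENNReal.ofReal (t / (1 + t)) • ((π.prod π).restrict A).map pb)

lemma lintegral_pert (π : Measure (E × E)) (t : ℝ) (A : Set ((E × E) × (E × E)))
    {F : E × E → ℝ≥0∞} (hF : Measurable F) :
    ∫⁻ p, F p ∂(pert π t A) = ∫⁻ q in Aᶜ, F q.1 ∂(π.prod π)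
      + (ENNReal.ofReal (1 / (1 + t)) * ∫⁻ q in A, F (pa t q) ∂(π.prod π)
        + ENNReal.ofReal (t / (1 + t)) * ∫⁻ q in A, F (pb q) ∂(π.prod π)) := by
  unfold pert
  rw [lintegral_add_measure, lintegral_add_measure, lintegral_smul_measure, lintegral_smul_measure,
    lintegral_map hF measurable_fst, lintegral_map hF (pa_meas t), lintegral_map hF pb_meas]
  rfl

lemma swap_lintegral (π : Measure (E × E)) [IsProbabilityMeasure π]
    {A : Set ((E × E) × (E × E))} (hA : MeasurableSet A) (hs : Prod.swap ⁻¹' A = A)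
    {G : (E × E) × (E × E) → ℝ≥0∞} (hG : Measurable G) :
    ∫⁻ q in A, G q.swap ∂(π.prod π) = ∫⁻ q in A, G q ∂(π.prod π) := by
  have h := (Measure.measurePreserving_swap (μ := π) (ν := π)).restrict_preimage hA
  rw [hs] at h
  exact h.lintegral_comp hG

lemma coef_sum {t : ℝ} (ht : 0 < t) :
    ENNReal.ofReal (1 / (1 + t)) + ENNReal.ofReal (t / (1 + t)) = 1 := by
  rw [← ENNReal.ofReal_add (by positivity) (by positivity), ← add_div, div_self (by positivity)]
  simp

lemma lintegral_split (π : Measure (E × E)) [IsProbabilityMeasure π]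
    {A : Set ((E × E) × (E × E))} (hA : MeasurableSet A) {F : E × E → ℝ≥0∞} (hF : Measurable F) :
    ∫⁻ p, F p ∂π = ∫⁻ q in Aᶜ, F q.1 ∂(π.prod π) + ∫⁻ q in A, F q.1 ∂(π.prod π) := by
  rw [add_comm, lintegral_add_compl _ hA]
  have : (π.prod π).map Prod.fst = π := by simp
  conv_lhs => rw [← this]
  rw [lintegral_map hF measurable_fst]

lemma pert_adm {μ ν : Measure E} {π : Measure (E × E)} [IsProbabilityMeasure π]
    (h : Adm μ ν π) {t : ℝ} (ht : 0 < t)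
    {A : Set ((E × E) × (E × E))} (hA : MeasurableSet A) (hs : Prod.swap ⁻¹' A = A) :
    Adm μ ν (pert π t A) := by
  constructor
  · rw [← h.1]
    refine Measure.ext_of_lintegral _ fun F hF => ?_
    rw [lintegral_map hF measurable_fst, lintegral_map hF measurable_fst,
      lintegral_pert _ _ _ (F := fun p : E × E => F p.1) (hF.comp measurable_fst),
      lintegral_split π hA (F := fun p : E × E => F p.1) (hF.comp measurable_fst)]
    simp only [pa, pb]
    rw [← add_mul, coef_sum ht, one_mul]
  · intro φ hφ hn
    refine (h.2 φ hφ hn).trans ?_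
    have hm : Measurable fun x => ENNReal.ofReal (φ x) := (convex_cont hφ).measurable.ennreal_ofReal
    rw [lintegral_map hm measurable_snd, lintegral_map hm measurable_snd,
      lintegral_pert _ _ _ (F := fun p : E × E => ENNReal.ofReal (φ p.2)) (hm.comp measurable_snd),
      lintegral_split π hA (F := fun p : E × E => ENNReal.ofReal (φ p.2)) (hm.comp measurable_snd)]
    have e := swap_lintegral π hA hs (G := fun q => ENNReal.ofReal (φ (pb q.swap).2))
      (hm.comp (measurable_snd.comp (pb_meas.comp measurable_swap)))
    simp only [Prod.swap_swap] at e
    rw [e]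
    gcongr _ + ?_
    rw [← lintegral_const_mul, ← lintegral_const_mul, ← lintegral_add_left]
    · refine lintegral_mono fun q => ?_
      simp only [pa, pb, Prod.fst_swap, Prod.snd_swap]
      rw [← ENNReal.ofReal_mul (by positivity), ← ENNReal.ofReal_mul (by positivity),
        ← ENNReal.ofReal_add (mul_nonneg (by positivity) (hn _)) (mul_nonneg (by positivity) (hn _))]
      apply ENNReal.ofReal_le_ofReal
      have h1 : (0:ℝ) < 1 + t := by linarith
      have := hφ.2 (mem_univ (q.1.2 - t • (q.2.1 - q.1.1))) (mem_univ (q.1.2 - (q.1.1 - q.2.1)))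
        (show (0:ℝ) ≤ 1 / (1 + t) by positivity) (show 0 ≤ t / (1 + t) by positivity)
        (by field_simp)
      have e1 : (1 / (1 + t) : ℝ) + t / (1 + t) = 1 := by field_simp
      have e2 : (1 / (1 + t) : ℝ) * t = t / (1 + t) := by field_simp
      have key : (1 / (1 + t) : ℝ) • (q.1.2 - t • (q.2.1 - q.1.1))
          + (t / (1 + t)) • (q.1.2 - (q.1.1 - q.2.1)) = q.1.2 := by
        have h3 : ((1 / (1 + t) : ℝ) + t / (1 + t)) • q.1.2 = q.1.2 := by rw [e1, one_smul]
        conv_rhs => rw [← h3]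
        simp only [smul_sub, smul_smul, e2, add_smul]
        abel
      rw [key] at this
      simpa only [smul_eq_mul] using this
    · exact (hm.comp (measurable_snd.comp (pa_meas t))).const_mul _
    · exact (hm.comp (measurable_snd.comp (pb_meas.comp measurable_swap)))
    · exact (hm.comp (measurable_snd.comp (pa_meas t)))

lemma cost_meas (ρ : ℝ) : Measurable fun p : E × E => ENNReal.ofReal (‖p.1 - p.2‖ ^ ρ) :=
  meas_norm_rpow (measurable_fst.sub measurable_snd) ρ

lemma twopoint_int {ρ : ℝ} {μ ν : Measure E} {π : Measure (E × E)} [IsProbabilityMeasure π]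
    (h : Opt ρ μ ν π) {t : ℝ} (ht : 0 < t)
    {A : Set ((E × E) × (E × E))} (hA : MeasurableSet A) (hs : Prod.swap ⁻¹' A = A) :
    ∫⁻ q in A, ENNReal.ofReal (‖q.1.1 - q.1.2‖ ^ ρ) ∂(π.prod π) ≤
      ∫⁻ q in A, ENNReal.ofReal (‖(pa t q).1 - (pa t q).2‖ ^ ρ) ∂(π.prod π) ∧
    ∫⁻ q in A, ENNReal.ofReal (‖q.1.1 - q.1.2‖ ^ ρ) ∂(π.prod π) ≠ ∞ := by
  have h1 := h.2.2 _ (pert_adm h.1 ht hA hs)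
  have hfin := h.2.1
  unfold cost at h1 hfin
  rw [lintegral_pert _ _ _ (cost_meas ρ), lintegral_split π hA (cost_meas ρ)] at h1
  rw [lintegral_split π hA (cost_meas ρ)] at hfin
  have e := swap_lintegral π hA hs (G := fun q => ENNReal.ofReal (‖q.1.1 - q.1.2‖ ^ ρ))
      ((cost_meas ρ).comp measurable_fst)
  have e2 : ∀ q : (E × E) × (E × E), (pb q).1 - (pb q).2 = q.swap.1.1 - q.swap.1.2 := by
    intro q; simp only [pb, Prod.fst_swap]; abel
  simp only [e2] at h1
  rw [e] at h1
  set a := ∫⁻ q in Aᶜ, ENNReal.ofReal (‖q.1.1 - q.1.2‖ ^ ρ) ∂(π.prod π)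
  set b := ∫⁻ q in A, ENNReal.ofReal (‖q.1.1 - q.1.2‖ ^ ρ) ∂(π.prod π)
  set c := ∫⁻ q in A, ENNReal.ofReal (‖(pa t q).1 - (pa t q).2‖ ^ ρ) ∂(π.prod π)
  have ha : a ≠ ∞ := ne_top_of_le_ne_top hfin le_self_add
  have hb : b ≠ ∞ := ne_top_of_le_ne_top hfin le_add_self
  refine ⟨?_, hb⟩
  have h2 := (ENNReal.add_le_add_iff_left ha).1 h1
  have h3 : ENNReal.ofReal (1 / (1 + t)) * b + ENNReal.ofReal (t / (1 + t)) * b ≤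
      ENNReal.ofReal (1 / (1 + t)) * c + ENNReal.ofReal (t / (1 + t)) * b := by
    rw [← add_mul, coef_sum ht, one_mul]; exact h2
  have h4 := (ENNReal.add_le_add_iff_right (by finiteness)).1 h3
  exact (ENNReal.mul_le_mul_iff_right (by simp; positivity) (by finiteness)).1 h4

lemma twopoint_ineq {ρ : ℝ} (hρ : 1 < ρ) {μ ν : Measure E} {π : Measure (E × E)}
    [IsProbabilityMeasure π] (h : Opt ρ μ ν π) {t : ℝ} (ht : 0 < t)
    {p p' : E × E} (hp : p ∈ π.support) (hp' : p' ∈ π.support) :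
    ‖p.1 - p.2‖ ^ ρ + ‖p'.1 - p'.2‖ ^ ρ ≤
      ‖(pa t (p, p')).1 - (pa t (p, p')).2‖ ^ ρ + ‖(pa t (p', p)).1 - (pa t (p', p)).2‖ ^ ρ := by
  by_contra! hlt
  have hρ0 : (0:ℝ) ≤ ρ := by linarith
  let f : (E × E) × (E × E) → ℝ := fun q => ‖q.1.1 - q.1.2‖ ^ ρ
  let g : (E × E) × (E × E) → ℝ := fun q => ‖(pa t q).1 - (pa t q).2‖ ^ ρ
  have hf : Continuous f := (by fun_prop : Continuous fun q : (E × E) × (E × E) =>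
    ‖q.1.1 - q.1.2‖).rpow_const fun _ => Or.inr hρ0
  have hg : Continuous g := (by unfold pa; fun_prop : Continuous fun q : (E × E) × (E × E) =>
    ‖(pa t q).1 - (pa t q).2‖).rpow_const fun _ => Or.inr hρ0
  have hf0 : ∀ q, 0 ≤ f q := fun q => by positivity
  have hg0 : ∀ q, 0 ≤ g q := fun q => by positivity
  let A : Set ((E × E) × (E × E)) := {q | g q + g q.swap < f q + f q.swap}
  have hAo : IsOpen A := isOpen_lt (hg.add (hg.comp continuous_swap))
    (hf.add (hf.comp continuous_swap))
  have hA : MeasurableSet A := hAo.measurableSet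
  have hs : Prod.swap ⁻¹' A = A := by
    ext q
    simp only [A, mem_preimage, mem_ofPred_eq, Prod.swap_swap]
    rw [add_comm (g q.swap), add_comm (f q.swap)]
  obtain ⟨h1, h2⟩ := twopoint_int h ht hA hs
  have hfm : Measurable fun q => ENNReal.ofReal (f q) := hf.measurable.ennreal_ofReal
  have hgm : Measurable fun q => ENNReal.ofReal (g q) := hg.measurable.ennreal_ofReal
  have ef := swap_lintegral π hA hs hfm
  have eg := swap_lintegral π hA hs hgm
  have hnull : (π.prod π) A = 0 := by
    have hle : ∫⁻ q in A, ENNReal.ofReal (f q + f q.swap) ∂(π.prod π) ≤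
        ∫⁻ q in A, ENNReal.ofReal (g q + g q.swap) ∂(π.prod π) := by
      simp_rw [ENNReal.ofReal_add (hf0 _) (hf0 _), ENNReal.ofReal_add (hg0 _) (hg0 _)]
      rw [lintegral_add_left hfm, lintegral_add_left hgm, ef, eg]
      exact add_le_add h1 h1
    have hfin : ∫⁻ q in A, ENNReal.ofReal (f q + f q.swap) ∂(π.prod π) ≠ ∞ := by
      simp_rw [ENNReal.ofReal_add (hf0 _) (hf0 _)]
      rw [lintegral_add_left hfm, ef]
      exact ENNReal.add_ne_top.2 ⟨h2, h2⟩
    by_contra hne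
    have hr : (π.prod π).restrict A ≠ 0 := by
      rwa [Ne, Measure.restrict_eq_zero]
    refine absurd hle (not_le.2 ?_)
    refine lintegral_strict_mono hr
      ((hf.add (hf.comp continuous_swap)).measurable.ennreal_ofReal.aemeasurable) ?_ ?_
    · refine ne_top_of_le_ne_top hfin ?_
      refine setLIntegral_mono ((hf.add (hf.comp continuous_swap)).measurable.ennreal_ofReal) ?_
      intro q hq
      exact ENNReal.ofReal_le_ofReal (le_of_lt hq)
    · filter_upwards [ae_restrict_mem hA] with q hq
      exact (ENNReal.ofReal_lt_ofReal_iff_of_nonneg (add_nonneg (hg0 _) (hg0 _))).2 hq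
  have hmem : (p, p') ∈ A := hlt
  have := hAo.mem_nhds hmem
  rw [nhds_prod_eq, Filter.mem_prod_iff] at this
  obtain ⟨U, hU, U', hU', hUU⟩ := this
  rw [Measure.mem_support_iff_forall] at hp hp'
  have hpos : 0 < (π.prod π) (U ×ˢ U') := by
    rw [Measure.prod_prod]
    exact ENNReal.mul_pos (hp U hU).ne' (hp' U' hU').ne'
  exact absurd (hpos.trans_le (measure_mono hUU)) (by rw [hnull]; simp)

/-- gradient of the cost (up to a factor) -/
def grd (ρ : ℝ) (z : E) : E := ‖z‖ ^ (ρ - 2) • z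

lemma grd_norm {ρ : ℝ} (hρ : 1 < ρ) (z : E) : ‖grd ρ z‖ = ‖z‖ ^ (ρ - 1) := by
  unfold grd
  rw [norm_smul, Real.norm_of_nonneg (by positivity)]
  rcases eq_or_ne z 0 with rfl | hz
  · simp [Real.zero_rpow (show ρ - 1 ≠ 0 by linarith)]
  · rw [← Real.rpow_add_one (norm_ne_zero_iff.2 hz)]; ring_nf

lemma grd_cont {ρ : ℝ} (hρ : 1 < ρ) : Continuous (grd (E := E) ρ) := by
  rw [continuous_iff_continuousAt]
  intro z
  rcases eq_or_ne z 0 with rfl | hz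
  · rw [ContinuousAt, show grd ρ (0:E) = 0 by simp [grd], tendsto_zero_iff_norm_tendsto_zero]
    simp_rw [grd_norm hρ]
    have : Continuous fun z : E => ‖z‖ ^ (ρ - 1) :=
      continuous_norm.rpow_const fun _ => Or.inr (by linarith)
    have h2 := this.tendsto 0
    simpa [Real.zero_rpow (show ρ - 1 ≠ 0 by linarith)] using h2
  · exact ((continuous_norm.continuousAt).rpow_const (Or.inl (norm_ne_zero_iff.2 hz))).smul
      continuousAt_id

lemma grd_inj {ρ : ℝ} (hρ : 1 < ρ) : Function.Injective (grd (E := E) ρ) := by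
  intro z w h
  have h1 : ‖z‖ = ‖w‖ := by
    have := congrArg norm h
    rw [grd_norm hρ, grd_norm hρ] at this
    exact (Real.rpow_left_inj (norm_nonneg _) (norm_nonneg _) (by linarith)).1 this
  rcases eq_or_ne w 0 with rfl | hw
  · simpa using h1
  · unfold grd at h
    rw [h1] at h
    exact smul_right_injective E (Real.rpow_pos_of_pos (norm_pos_iff.2 hw) _).ne' h

lemma monotone_support {ρ : ℝ} (hρ : 1 < ρ) {μ ν : Measure E} {π : Measure (E × E)}
    [IsProbabilityMeasure π] (h : Opt ρ μ ν π)
    {p p' : E × E} (hp : p ∈ π.support) (hp' : p' ∈ π.support) :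
    0 ≤ inner ℝ (grd ρ (p'.2 - p'.1) - grd ρ (p.2 - p.1)) (p'.1 - p.1) := by
  set z := p.2 - p.1
  set z' := p'.2 - p'.1
  set v := p'.1 - p.1
  have hd : ∀ (z v : E), HasDerivAt (fun t : ℝ => ‖z + t • v‖ ^ ρ) (ρ * inner ℝ (grd ρ z) v) 0 := by
    intro z v
    have h1 : HasDerivAt (fun t : ℝ => z + t • v) v 0 := by
      simpa using ((hasDerivAt_id (0:ℝ)).smul_const v).const_add z
    have h2 := hasFDerivAt_norm_rpow (z + (0:ℝ) • v) hρ
    have h3 := h2.comp_hasDerivAt (0:ℝ) h1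
    simp only [zero_smul, add_zero] at h3
    convert! h3 using 1
    simp [grd, real_inner_smul_left, mul_assoc]
  have hD := (hd z (-v)).add (hd z' v)
  have hineq : ∀ t : ℝ, 0 < t → ‖z‖ ^ ρ + ‖z'‖ ^ ρ ≤ ‖z + t • (-v)‖ ^ ρ + ‖z' + t • v‖ ^ ρ := by
    intro t ht
    have := twopoint_ineq hρ h ht hp hp'
    simp only [pa] at this
    convert this using 3
    · rw [norm_sub_rev]
    · rw [norm_sub_rev]
    · rw [norm_sub_rev]; congr 1; simp only [smul_neg, z, v]; abel
    · rw [norm_sub_rev]; congr 1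
      rw [← neg_sub p'.1 p.1, smul_neg]; simp only [z', v]; abel
  have hnn := ge_of_tendsto (hD.tendsto_slope_zero_right) (b := 0) ?_
  · simp only [inner_neg_right] at hnn
    rw [inner_sub_left]
    have hρ0 : 0 < ρ := by linarith
    by_contra! hneg
    nlinarith
  filter_upwards [self_mem_nhdsWithin] with t ht
  have ht : 0 < t := ht
  have := hineq t ht
  simp only [zero_add, zero_smul, add_zero, Pi.add_apply, smul_eq_mul]
  have h2 : 0 ≤ t⁻¹ := by positivity
  exact mul_nonneg h2 (by linarith)

end TwoPoint

section AC

set_option linter.unusedSectionVars false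

variable {E : Type*} [NormedAddCommGroup E] [InnerProductSpace ℝ E] [FiniteDimensional ℝ E]
  [MeasurableSpace E] [BorelSpace E]

/-- The average of two plans. -/
def avg (π₀ π₁ : Measure (E × E)) : Measure (E × E) := (2:ℝ≥0∞)⁻¹ • (π₀ + π₁)

lemma half_add {a b c : ℝ≥0∞} (h : a ≤ b) (h' : a ≤ c) : a ≤ 2⁻¹ * (b + c) := by
  calc a = 2⁻¹ * (a + a) := by
        rw [← two_mul, ← mul_assoc, ENNReal.inv_mul_cancel (by simp) (by simp), one_mul]
    _ ≤ _ := by gcongr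

lemma half_add' (a : ℝ≥0∞) : 2⁻¹ * (a + a) = a := by
  rw [← two_mul, ← mul_assoc, ENNReal.inv_mul_cancel (by simp) (by simp), one_mul]

lemma avg_opt {ρ : ℝ} {μ ν : Measure E} {π₀ π₁ : Measure (E × E)}
    (h₀ : Opt ρ μ ν π₀) (h₁ : Opt ρ μ ν π₁) : Opt ρ μ ν (avg π₀ π₁) := by
  have hc : cost ρ π₁ = cost ρ π₀ := le_antisymm (h₁.2.2 _ h₀.1) (h₀.2.2 _ h₁.1)
  have hcost : cost ρ (avg π₀ π₁) = cost ρ π₀ := by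
    have : cost ρ (avg π₀ π₁) = 2⁻¹ * (cost ρ π₀ + cost ρ π₁) := by
      unfold cost avg
      rw [lintegral_smul_measure, lintegral_add_measure]; rfl
    rw [this, hc, half_add']
  refine ⟨⟨?_, ?_⟩, ?_, ?_⟩
  · unfold avg
    rw [Measure.map_smul, Measure.map_add _ _ measurable_fst, h₀.1.1, h₁.1.1]
    ext s _
    simp only [Measure.smul_apply, Measure.add_apply, smul_eq_mul, half_add']
  · intro φ hφ hn
    unfold avg
    rw [Measure.map_smul, Measure.map_add _ _ measurable_snd, lintegral_smul_measure,
      lintegral_add_measure]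
    exact half_add (h₀.1.2 φ hφ hn) (h₁.1.2 φ hφ hn)
  · rw [hcost]; exact h₀.2.1
  · intro π' h'; rw [hcost]; exact h₀.2.2 _ h'

/-- Points where the gradient in direction `v` takes values on both sides of a gap. -/
def gap (ρ : ℝ) (Γ : Set (E × E)) (v : E) (q q' : ℝ) : Set E :=
  Prod.fst '' (Γ ∩ {p | inner ℝ (grd ρ (p.2 - p.1)) v ≤ q}) ∩
  Prod.fst '' (Γ ∩ {p | q' ≤ inner ℝ (grd ρ (p.2 - p.1)) v})

lemma image_meas {Γ : Set (E × E)} (h : IsClosed Γ) : MeasurableSet (Prod.fst '' Γ) := by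
  have h1 : IsSigmaCompact (Prod.fst '' Γ) :=
    (isSigmaCompact_univ.of_isClosed_subset h (subset_univ _)).image continuous_fst
  obtain ⟨K, hK, hU⟩ := h1
  rw [← hU]
  exact MeasurableSet.iUnion fun n => (hK n).measurableSet

lemma gap_meas {ρ : ℝ} (hρ : 1 < ρ) {Γ : Set (E × E)} (h : IsClosed Γ) (v : E) (q q' : ℝ) :
    MeasurableSet (gap ρ Γ v q q') := by
  have hc : Continuous fun p : E × E => inner ℝ (grd ρ (p.2 - p.1)) v :=
    ((grd_cont hρ).comp (continuous_snd.sub continuous_fst)).inner continuous_const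
  exact (image_meas (h.inter (isClosed_le hc continuous_const))).inter
    (image_meas (h.inter (isClosed_le continuous_const hc)))

lemma gap_null {ρ : ℝ} (hρ : 1 < ρ) {Γ : Set (E × E)} (h : IsClosed Γ)
    (hmono : ∀ p ∈ Γ, ∀ p' ∈ Γ,
      0 ≤ inner ℝ (grd ρ (p'.2 - p'.1) - grd ρ (p.2 - p.1)) (p'.1 - p.1))
    (m : Measure E) [m.IsAddHaarMeasure] (v : E) {q q' : ℝ} (hq : q < q') :
    m (gap ρ Γ v q q') = 0 := by
  have key : ∀ y : E, ∀ s₁ s₂ : ℝ, s₁ < s₂ → y + s₁ • v ∈ gap ρ Γ v q q' →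
      y + s₂ • v ∈ gap ρ Γ v q q' → False := by
    rintro y s₁ s₂ hs ⟨-, p, ⟨hp, hpq⟩, e⟩ ⟨⟨p', ⟨hp', hpq'⟩, e'⟩, -⟩
    have h1 := hmono p hp p' hp'
    have h2 : p'.1 - p.1 = (s₂ - s₁) • v := by rw [e, e', sub_smul]; abel
    rw [h2, real_inner_smul_right, inner_sub_left] at h1
    simp only [mem_ofPred_eq] at hpq hpq'
    have : 0 < s₂ - s₁ := by linarith
    nlinarith
  have := ae_mem_of_ae_add_linearMap_mem (LinearMap.toSpanSingleton ℝ E v) (volume : Measure ℝ) m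
    (gap_meas hρ h v q q').compl ?_
  · rw [ae_iff] at this
    simpa using this
  · intro y
    rw [ae_iff]
    have hsub : {a : ℝ | ¬ (y + (LinearMap.toSpanSingleton ℝ E v) a ∈ (gap ρ Γ v q q')ᶜ)}.Subsingleton := by
      intro a ha b hb
      simp only [mem_ofPred_eq, mem_compl_iff, not_not, LinearMap.toSpanSingleton_apply] at ha hb
      rcases lt_trichotomy a b with h | h | h
      · exact (key y a b h ha hb).elim
      · exact h
      · exact (key y b a h hb ha).elim
    exact hsub.countable.measure_zero _

theorem ac_unique {ρ : ℝ} (hρ : 1 < ρ) {μ ν : Measure E} [IsProbabilityMeasure ν]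
    (m : Measure E) [m.IsAddHaarMeasure] (hac : ν ≪ m) {π₀ π₁ : Measure (E × E)}
    (h₀ : Opt ρ μ ν π₀) (h₁ : Opt ρ μ ν π₁) : π₀ = π₁ := by
  have hopt := avg_opt h₀ h₁
  have : IsProbabilityMeasure (avg π₀ π₁) := prob_of_map measurable_fst hopt.1.1
  set Γ := (avg π₀ π₁).support
  have hΓc : IsClosed Γ := Measure.isClosed_support
  have hmono : ∀ p ∈ Γ, ∀ p' ∈ Γ,
      0 ≤ inner ℝ (grd ρ (p'.2 - p'.1) - grd ρ (p.2 - p.1)) (p'.1 - p.1) :=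
    fun p hp p' hp' => monotone_support hρ hopt hp hp'
  let b := stdOrthonormalBasis ℝ E
  let N : Set E := ⋃ (i : Fin (Module.finrank ℝ E)) (r : {r : ℚ × ℚ // r.1 < r.2}),
    gap ρ Γ (b i) (r.1.1 : ℝ) (r.1.2 : ℝ)
  have hNm : MeasurableSet N := MeasurableSet.iUnion fun i => MeasurableSet.iUnion fun r =>
    gap_meas hρ hΓc _ _ _
  have hN0 : ν N = 0 := by
    apply hac
    refine measure_iUnion_null fun i => measure_iUnion_null fun r => ?_
    exact gap_null hρ hΓc hmono m (b i) (by exact_mod_cast r.2)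
  let Γ' : Set (E × E) := Γ ∩ Prod.fst ⁻¹' Nᶜ
  have hΓ'm : MeasurableSet Γ' := hΓc.measurableSet.inter (measurable_fst hNm.compl)
  have hinj : InjOn Prod.fst Γ' := by
    rintro ⟨x, y⟩ ⟨hp, hpN⟩ ⟨x', y'⟩ ⟨hp', hpN'⟩ (rfl : x = x')
    have hg : grd ρ (y - x) = grd ρ (y' - x) := by
      suffices hi : ∀ i, inner ℝ (grd ρ (y - x)) (b i) = inner ℝ (grd ρ (y' - x)) (b i) by
        apply b.repr.injective
        ext i
        rw [b.repr_apply_apply, b.repr_apply_apply, real_inner_comm, hi i, real_inner_comm]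
      intro i
      by_contra hne
      have aux : ∀ z z' : E, (x, z) ∈ Γ → (x, z') ∈ Γ →
          ¬ (inner ℝ (grd ρ (z - x)) (b i) < inner ℝ (grd ρ (z' - x)) (b i)) := by
        intro z z' hz hz' hlt
        obtain ⟨q, hq1, hq2⟩ := exists_rat_btwn hlt
        obtain ⟨q', hq1', hq2'⟩ := exists_rat_btwn hq2
        apply hpN
        refine mem_iUnion.2 ⟨i, mem_iUnion.2 ⟨⟨(q, q'), by exact_mod_cast hq1'⟩, ?_⟩⟩
        exact ⟨⟨(x, z), ⟨hz, hq1.le⟩, rfl⟩, ⟨(x, z'), ⟨hz', hq2'.le⟩, rfl⟩⟩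
      rcases lt_or_gt_of_ne hne with hlt | hlt
      · exact aux _ _ hp hp' hlt
      · exact aux _ _ hp' hp hlt
    have := grd_inj hρ hg
    rw [sub_left_inj] at this
    rw [this]
  have hfull : (avg π₀ π₁) Γ'ᶜ = 0 := by
    have h1 : (avg π₀ π₁) Γᶜ = 0 := Measure.support_mem_ae
    have h2 : (avg π₀ π₁) (Prod.fst ⁻¹' N) = 0 := by
      rw [← Measure.map_apply measurable_fst hNm, hopt.1.1, hN0]
    refine measure_mono_null (fun p hp => ?_) (measure_union_null h1 h2)
    by_contra hcon
    simp only [mem_union, not_or, mem_compl_iff, not_not] at hcon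
    exact hp ⟨hcon.1, hcon.2⟩
  have hf : π₀ Γ'ᶜ = 0 ∧ π₁ Γ'ᶜ = 0 := by
    simpa [avg] using hfull
  have key : ∀ π : Measure (E × E), π.map Prod.fst = ν → π Γ'ᶜ = 0 → ∀ B, MeasurableSet B →
      π B = ν (Prod.fst '' (B ∩ Γ')) := by
    intro π hπ h0 B hB
    have him : MeasurableSet (Prod.fst '' (B ∩ Γ')) :=
      (hB.inter hΓ'm).image_of_measurable_injOn measurable_fst (hinj.mono inter_subset_right)
    rw [← hπ, Measure.map_apply measurable_fst him]
    apply measure_congr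
    have hae : ∀ᵐ p ∂π, p ∈ Γ' := h0
    filter_upwards [hae] with p hp
    refine propext ⟨fun h => ⟨p, ⟨h, hp⟩, rfl⟩, ?_⟩
    rintro ⟨p', ⟨hB', hp'⟩, e⟩
    rw [← hinj hp' hp e]; exact hB'
  ext B hB
  rw [key π₀ h₀.1.1 hf.1 B hB, key π₁ h₁.1.1 hf.2 B hB]

end AC

section Quantile

/-- Uniform measure on `(0,1)`. -/
def U01 : Measure ℝ := volume.restrict (Ioo 0 1)

instance : IsProbabilityMeasure U01 := ⟨by simp [U01]⟩

/-- Quantile function. -/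
def qf (m : Measure ℝ) (u : ℝ) : ℝ :=
  (Ioo (0:ℝ) 1).indicator (fun u => sInf {x | u ≤ cdf m x}) u

lemma qf_le_iff (m : Measure ℝ) {u : ℝ} (hu : u ∈ Ioo (0:ℝ) 1) (x : ℝ) :
    qf m u ≤ x ↔ u ≤ cdf m x := by
  unfold qf
  rw [indicator_of_mem hu]
  have hne : {x | u ≤ cdf m x}.Nonempty :=
    ((tendsto_cdf_atTop m).eventually (eventually_ge_nhds hu.2)).exists
  obtain ⟨a, ha⟩ := ((tendsto_cdf_atBot m).eventually (eventually_lt_nhds hu.1)).exists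
  have hbdd : BddBelow {x | u ≤ cdf m x} := by
    refine ⟨a, fun x hx => ?_⟩
    by_contra! h
    exact absurd ((monotone_cdf m) h.le) (not_le.2 (ha.trans_le hx))
  constructor
  · intro h
    have h1 : ∀ y, x < y → u ≤ cdf m y := by
      intro y hy
      obtain ⟨z, hz, hzy⟩ := exists_lt_of_csInf_lt hne (h.trans_lt hy)
      exact le_trans hz (monotone_cdf m hzy.le)
    have h2 : Tendsto (cdf m) (𝓝[>] x) (𝓝 (cdf m x)) :=
      ((cdf m).right_continuous x).mono_left (nhdsWithin_mono _ Ioi_subset_Ici_self)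
    refine ge_of_tendsto h2 ?_
    filter_upwards [self_mem_nhdsWithin] with y hy using h1 y hy
  · intro h
    exact csInf_le hbdd h

lemma qf_mono (m : Measure ℝ) {u v : ℝ} (hu : u ∈ Ioo (0:ℝ) 1) (hv : v ∈ Ioo (0:ℝ) 1)
    (h : u ≤ v) : qf m u ≤ qf m v := by
  rw [qf_le_iff m hu]
  exact h.trans ((qf_le_iff m hv _).1 le_rfl)

lemma qf_meas (m : Measure ℝ) : Measurable (qf m) := by
  apply measurable_of_Iic
  intro x
  have : qf m ⁻¹' Iic x = (Ioo 0 1 ∩ Iic (cdf m x)) ∪ ((Ioo 0 1)ᶜ ∩ {_u | (0:ℝ) ≤ x}) := by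
    ext u
    by_cases hu : u ∈ Ioo (0:ℝ) 1
    · simp only [mem_preimage, mem_Iic, qf_le_iff m hu, mem_union, mem_inter_iff, hu, true_and,
        mem_compl_iff, not_true, false_and, or_false]
    · simp only [mem_preimage, mem_Iic, mem_union, mem_inter_iff, hu, false_and, mem_compl_iff,
        not_false_eq_true, true_and, false_or, qf, indicator_of_notMem, mem_ofPred_eq]
  rw [this]
  exact (measurableSet_Ioo.inter measurableSet_Iic).union
    (measurableSet_Ioo.compl.inter (MeasurableSet.const _))

lemma U01_Iic {c : ℝ} (_h0 : 0 ≤ c) (h1 : c ≤ 1) : U01 (Iic c) = ENNReal.ofReal c := by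
  unfold U01
  rw [Measure.restrict_congr_set Ioo_ae_eq_Ioc, Measure.restrict_apply measurableSet_Iic]
  have : Iic c ∩ Ioc 0 1 = Ioc 0 c := by
    ext x; simp only [mem_inter_iff, mem_Iic, mem_Ioc]
    constructor
    · rintro ⟨a, b, _⟩; exact ⟨b, a⟩
    · rintro ⟨a, b⟩; exact ⟨b, a, b.trans h1⟩
  rw [this]; simp

lemma U01_ae : ∀ᵐ u ∂U01, u ∈ Ioo (0:ℝ) 1 := ae_restrict_mem measurableSet_Ioo

lemma ext_Iic_prod {P Q : Measure (ℝ × ℝ)} [IsProbabilityMeasure P] [IsProbabilityMeasure Q]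
    (h : ∀ x y, P (Iic x ×ˢ Iic y) = Q (Iic x ×ˢ Iic y)) : P = Q := by
  have hspan : IsCountablySpanning (range (Iic : ℝ → Set ℝ)) :=
    ⟨fun n : ℕ => Iic (n : ℝ), fun n => ⟨_, rfl⟩, iUnion_Iic_of_not_bddAbove_range
      (by
        rintro ⟨b, hb⟩
        obtain ⟨n, hn⟩ := exists_nat_gt b
        exact absurd (hb ⟨n, rfl⟩) (not_le.2 hn))⟩
  have hg : MeasurableSpace.generateFrom (range (Iic : ℝ → Set ℝ)) = (borel ℝ) :=
    (borel_eq_generateFrom_Iic ℝ).symm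
  have hg' := generateFrom_eq_prod (hg.trans (BorelSpace.measurable_eq (α := ℝ)).symm)
    (hg.trans (BorelSpace.measurable_eq (α := ℝ)).symm) hspan hspan
  refine ext_of_generate_finite _ hg'.symm ((isPiSystem_Iic).prod isPiSystem_Iic) ?_ (by simp)
  rintro _ ⟨_, ⟨x, rfl⟩, _, ⟨y, rfl⟩, rfl⟩
  exact h x y

lemma law_pair_Iic (m m' : Measure ℝ) [IsProbabilityMeasure m] [IsProbabilityMeasure m'] (x y : ℝ) :
    (U01.map fun u => (qf m u, qf m' u)) (Iic x ×ˢ Iic y) = min (m (Iic x)) (m' (Iic y)) := by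
  rw [Measure.map_apply ((qf_meas m).prodMk (qf_meas m'))
    (measurableSet_Iic.prod measurableSet_Iic), ← ofReal_cdf, ← ofReal_cdf, ← ENNReal.ofReal_min,
    ← U01_Iic (le_min (cdf_nonneg _ _) (cdf_nonneg _ _)) ((min_le_left _ _).trans (cdf_le_one _ _))]
  apply measure_congr
  filter_upwards [U01_ae] with u hu
  apply propext
  change (qf m u ≤ x ∧ qf m' u ≤ y) ↔ u ≤ min _ _
  rw [qf_le_iff m hu, qf_le_iff m' hu, le_min_iff]

lemma law_qf (m : Measure ℝ) [IsProbabilityMeasure m] : U01.map (qf m) = m := by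
  have := Measure.isProbabilityMeasure_map (μ := U01) (qf_meas m).aemeasurable
  refine Measure.ext_of_Iic _ _ fun x => ?_
  rw [Measure.map_apply (qf_meas m) measurableSet_Iic, ← ofReal_cdf,
    ← U01_Iic (cdf_nonneg _ _) (cdf_le_one _ _)]
  apply measure_congr
  filter_upwards [U01_ae] with u hu
  exact propext (qf_le_iff m hu x)

lemma law_comonotone {P : Measure (ℝ × ℝ)} [IsProbabilityMeasure P]
    (h : ∀ p ∈ P.support, ∀ p' ∈ P.support, p.1 < p'.1 → p.2 ≤ p'.2) :
    P = U01.map fun u => (qf (P.map Prod.fst) u, qf (P.map Prod.snd) u) := by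
  have h1 := Measure.isProbabilityMeasure_map (μ := P) measurable_fst.aemeasurable
  have h2 := Measure.isProbabilityMeasure_map (μ := P) measurable_snd.aemeasurable
  have := Measure.isProbabilityMeasure_map (μ := U01)
    ((qf_meas (P.map Prod.fst)).prodMk (qf_meas (P.map Prod.snd))).aemeasurable
  refine ext_Iic_prod fun x y => ?_
  rw [law_pair_Iic, Measure.map_apply measurable_fst measurableSet_Iic,
    Measure.map_apply measurable_snd measurableSet_Iic]
  have hs : ∀ᵐ p ∂P, p ∈ P.support := Measure.support_mem_ae
  apply le_antisymm
  · exact le_min (measure_mono fun p hp => hp.1) (measure_mono fun p hp => hp.2)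
  · by_cases hc : ∃ p ∈ P.support, p.1 ≤ x ∧ y < p.2
    · obtain ⟨p, hp, hpx, hpy⟩ := hc
      refine (min_le_right _ _).trans (measure_mono_ae ?_)
      filter_upwards [hs] with p' hp' hy
      refine ⟨?_, hy⟩
      change p'.1 ≤ x
      by_contra! hlt
      exact absurd (h p hp p' hp' (hpx.trans_lt hlt)) (not_le.2 (lt_of_le_of_lt hy hpy))
    · push Not at hc
      refine (min_le_left _ _).trans (measure_mono_ae ?_)
      filter_upwards [hs] with p' hp' hx
      exact ⟨hx, hc p' hp' hx⟩

end Quantile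

section ConvexOrderMid

lemma subgrad {φ : ℝ → ℝ} (hφ : ConvexOn ℝ univ φ) {K : NNReal} (hK : LipschitzWith K φ) :
    ∃ ψ : ℝ → ℝ, Monotone ψ ∧ (∀ x, |ψ x| ≤ K) ∧ ∀ x y, φ x + ψ x * (y - x) ≤ φ y := by
  have hi : ∀ x : ℝ, x ∈ interior (univ : Set ℝ) := fun x => by simp
  have key : ∀ x y, φ x + derivWithin φ (Ioi x) x * (y - x) ≤ φ y := by
    intro x y
    rcases lt_trichotomy x y with h | h | h
    · have := hφ.rightDeriv_le_slope_of_mem_interior (hi x) (mem_univ y) h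
      rw [slope_def_field, le_div_iff₀ (by linarith)] at this
      linarith
    · subst h; simp
    · have h1 := hφ.slope_le_leftDeriv_of_mem_interior (mem_univ y) (hi x) h
      have h2 := h1.trans (hφ.leftDeriv_le_rightDeriv_of_mem_interior (hi x))
      rw [slope_def_field, div_le_iff₀ (by linarith)] at h2
      linarith
  refine ⟨fun x => derivWithin φ (Ioi x) x, ?_, ?_, key⟩
  · intro x y h
    exact hφ.monotoneOn_rightDeriv (hi x) (hi y) h
  · intro x
    have h1 := key x (x + 1)
    have h2 := key x (x - 1)
    have h3 := hK.dist_le_mul (x + 1) x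
    have h4 := hK.dist_le_mul (x - 1) x
    simp only [Real.dist_eq] at h3 h4
    norm_num at h3 h4
    rw [abs_le] at h3 h4 ⊢
    constructor <;> linarith

/-- Relative up-sets of `(0,1)`. -/
def Up (S : Set ℝ) : Prop := ∀ u ∈ S, u ∈ Ioo (0:ℝ) 1 → ∀ v ∈ Ioo (0:ℝ) 1, u ≤ v → v ∈ S

lemma upset_int {X Y : ℝ → ℝ} (hX : Integrable X U01) (hY : Integrable Y U01)
    (hm : ∀ u ∈ Ioo (0:ℝ) 1, ∀ v ∈ Ioo (0:ℝ) 1, u ≤ v → Y u ≤ Y v)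
    (hE : ∫ u, X u ∂U01 = ∫ u, Y u ∂U01)
    (hk : ∀ k : ℝ, ∫ u, max (X u - k) 0 ∂U01 ≤ ∫ u, max (Y u - k) 0 ∂U01)
    {S : Set ℝ} (hS : MeasurableSet S) (hup : Up S) : 0 ≤ ∫ u in S, (Y u - X u) ∂U01 := by
  by_cases h1 : ∃ u ∈ Ioo (0:ℝ) 1, u ∈ S
  swap
  · push Not at h1
    have : U01 S = 0 := by
      rw [← compl_compl S, ← mem_ae_iff]
      filter_upwards [U01_ae] with u hu using h1 u hu
    rw [Measure.restrict_eq_zero.2 this]; simp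
  by_cases h2 : ∃ u ∈ Ioo (0:ℝ) 1, u ∉ S
  swap
  · push Not at h2
    have : ∀ᵐ u ∂U01, u ∈ S := by filter_upwards [U01_ae] with u hu using h2 u hu
    rw [Measure.restrict_eq_self_of_ae_mem this, integral_sub hY hX, hE, sub_self]
  obtain ⟨a, ha, haS⟩ := h1
  obtain ⟨b, hb, hbS⟩ := h2
  set k := sInf (Y '' (S ∩ Ioo 0 1)) with hkdef
  have hlt : ∀ v ∈ Ioo (0:ℝ) 1, v ∉ S → ∀ s ∈ S ∩ Ioo (0:ℝ) 1, Y v ≤ Y s := by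
    intro v hv hvS s hs
    refine hm v hv s hs.2 ?_
    by_contra! hc
    exact hvS (hup s hs.1 hs.2 v hv hc.le)
  have hbdd : BddBelow (Y '' (S ∩ Ioo 0 1)) :=
    ⟨Y b, by rintro _ ⟨s, hs, rfl⟩; exact hlt b hb hbS s hs⟩
  have hin : ∀ u ∈ Ioo (0:ℝ) 1, u ∈ S → k ≤ Y u := fun u hu hS => csInf_le hbdd ⟨u, ⟨hS, hu⟩, rfl⟩
  have hout : ∀ u ∈ Ioo (0:ℝ) 1, u ∉ S → Y u ≤ k := fun u hu hS =>
    le_csInf ⟨_, a, ⟨haS, ha⟩, rfl⟩ (by rintro _ ⟨s, hs, rfl⟩; exact hlt u hu hS s hs)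
  have hYk : Integrable (fun u => Y u - k) U01 := hY.sub (integrable_const k)
  have hXk : Integrable (fun u => X u - k) U01 := hX.sub (integrable_const k)
  have e1 : ∫ u in S, (Y u - k) ∂U01 = ∫ u, max (Y u - k) 0 ∂U01 := by
    rw [← integral_indicator hS]
    apply integral_congr_ae
    filter_upwards [U01_ae] with u hu
    by_cases huS : u ∈ S
    · rw [indicator_of_mem huS, max_eq_left]; linarith [hin u hu huS]
    · rw [indicator_of_notMem huS, max_eq_right]; linarith [hout u hu huS]
  have e2 : ∫ u in S, (X u - k) ∂U01 ≤ ∫ u, max (X u - k) 0 ∂U01 := by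
    rw [← integral_indicator hS]
    apply integral_mono (hXk.indicator hS) hXk.pos_part
    intro u
    by_cases huS : u ∈ S
    · rw [indicator_of_mem huS]; exact le_max_left _ _
    · rw [indicator_of_notMem huS]; exact le_max_right _ _
  have e3 : ∫ u in S, (Y u - X u) ∂U01 = ∫ u in S, (Y u - k) ∂U01 - ∫ u in S, (X u - k) ∂U01 := by
    rw [← integral_sub hYk.integrableOn hXk.integrableOn]
    congr 1; ext u; ring
  rw [e3]
  linarith [hk k]

lemma mono_int {g D : ℝ → ℝ} (hg : Measurable g) {K : ℝ} (hK : ∀ u, |g u| ≤ K)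
    (hmono : ∀ u ∈ Ioo (0:ℝ) 1, ∀ v ∈ Ioo (0:ℝ) 1, u ≤ v → g u ≤ g v)
    (hD : Integrable D U01) (hD0 : ∫ u, D u ∂U01 = 0)
    (h : ∀ S, MeasurableSet S → Up S → 0 ≤ ∫ u in S, D u ∂U01) :
    0 ≤ ∫ u, g u * D u ∂U01 := by
  have hgD : Integrable (fun u => g u * D u) U01 :=
    hD.bdd_mul (c := K) hg.aestronglyMeasurable (ae_of_all _ hK)
  have e0 : ∫ u, g u * D u ∂U01 = ∫ u, (g u + K) * D u ∂U01 := by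
    simp_rw [add_mul]
    rw [integral_add hgD (hD.const_mul K), integral_const_mul, hD0]; simp
  let A : Set (ℝ × ℝ) := {p | p.2 < g p.1}
  have hA : MeasurableSet A := measurableSet_lt measurable_snd (hg.comp measurable_fst)
  let ν : Measure ℝ := volume.restrict (Ioc (-K) K)
  have hIntg : Integrable (A.indicator fun p : ℝ × ℝ => D p.1) (U01.prod ν) :=
    (hD.comp_fst ν).indicator hA
  have e1 : ∀ u, (g u + K) * D u = ∫ t, A.indicator (fun p : ℝ × ℝ => D p.1) (u, t) ∂ν := by
    intro u
    have : ∀ t, A.indicator (fun p : ℝ × ℝ => D p.1) (u, t)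
        = (Iio (g u)).indicator (fun _ => D u) t := by
      intro t; rfl
    simp_rw [this]
    rw [integral_indicator measurableSet_Iio, setIntegral_const, smul_eq_mul]
    congr 1
    have h2 := abs_le.1 (hK u)
    have : Iio (g u) ∩ Ioc (-K) K = Ioo (-K) (g u) := by
      ext t; simp only [mem_inter_iff, mem_Iio, mem_Ioc, mem_Ioo]
      constructor
      · rintro ⟨a, b, c⟩; exact ⟨b, a⟩
      · rintro ⟨a, b⟩; exact ⟨b, a, by linarith⟩
    rw [measureReal_restrict_apply measurableSet_Iio, this, Real.volume_real_Ioo_of_le (by linarith)]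
    ring
  rw [e0]
  simp_rw [e1]
  rw [integral_integral_swap (f := fun u t => A.indicator (fun p : ℝ × ℝ => D p.1) (u, t)) hIntg]
  refine integral_nonneg fun t => ?_
  have hS : MeasurableSet {u | t < g u} := measurableSet_lt measurable_const hg
  have : ∀ u, A.indicator (fun p : ℝ × ℝ => D p.1) (u, t) = {u | t < g u}.indicator D u :=
    fun u => rfl
  simp_rw [this]
  change 0 ≤ ∫ u, _ ∂U01
  rw [integral_indicator hS]
  exact h _ hS fun u hu hu1 v hv huv => lt_of_lt_of_le hu (hmono u hu1 v hv huv)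

lemma integrable_of_mom {ρ : ℝ} (hρ : 1 < ρ) {m : Measure ℝ} [IsProbabilityMeasure m]
    (h : mom ρ m ≠ ∞) : Integrable (fun x => x) m := by
  have h1 : Integrable (fun x : ℝ => ‖x‖ ^ ρ) m := by
    refine ⟨(measurable_norm.pow_const ρ).aestronglyMeasurable, ?_⟩
    rw [hasFiniteIntegral_iff_ofReal (ae_of_all _ fun x => by positivity)]
    exact lt_top_iff_ne_top.2 h
  refine ((integrable_const (1:ℝ)).add h1).mono' aestronglyMeasurable_id (ae_of_all _ fun x => ?_)
  simp only [Pi.add_apply]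
  rcases le_total ‖x‖ 1 with h | h
  · have : 0 ≤ ‖x‖ ^ ρ := by positivity
    linarith
  · have := Real.rpow_le_rpow_of_exponent_le h hρ.le
    rw [Real.rpow_one] at this
    linarith

lemma qf_integrable {m : Measure ℝ} [IsProbabilityMeasure m] (h : Integrable (fun x => x) m) :
    Integrable (qf m) U01 := by
  rw [← law_qf m] at h
  exact (integrable_map_measure aestronglyMeasurable_id (qf_meas m).aemeasurable).1 h

lemma integral_qf (m : Measure ℝ) [IsProbabilityMeasure m] {f : ℝ → ℝ} (hf : Continuous f) :
    ∫ u, f (qf m u) ∂U01 = ∫ x, f x ∂m := by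
  conv_rhs => rw [← law_qf m]
  rw [integral_map (qf_meas m).aemeasurable hf.aestronglyMeasurable]

lemma qf_order {μ η : Measure ℝ} [IsProbabilityMeasure μ] [IsProbabilityMeasure η]
    (hμ : Integrable (fun x => x) μ) (hη : Integrable (fun x => x) η) (h : CX μ η) :
    ∫ u, qf μ u ∂U01 = ∫ u, qf η u ∂U01 ∧ ∀ S, MeasurableSet S → Up S →
      0 ≤ ∫ u in S, (qf η u - qf μ u) ∂U01 := by
  have ho := h.convexOrder.2
  have hmean : ∫ u, qf μ u ∂U01 = ∫ u, qf η u ∂U01 := by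
    rw [integral_qf μ (f := fun x => x) continuous_id, integral_qf η (f := fun x => x) continuous_id]
    apply le_antisymm
    · exact ho (fun x => x) (convexOn_id convex_univ) (hμ.add_measure hη)
    · have := ho (fun x => -x) ((concaveOn_id convex_univ).neg) (hμ.add_measure hη).neg
      rw [integral_neg, integral_neg] at this
      linarith
  refine ⟨hmean, fun S hS hup => upset_int (qf_integrable hμ) (qf_integrable hη)
    (fun u hu v hv => qf_mono η hu hv) hmean (fun k => ?_) hS hup⟩
  have hc : Continuous fun x : ℝ => max (x - k) 0 := by fun_prop
  rw [integral_qf μ hc, integral_qf η hc]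
  refine ho _ ?_ ?_
  · exact ((convexOn_id convex_univ).sub (concaveOn_const k convex_univ)).sup
      (convexOn_const 0 convex_univ)
  · exact ((hμ.sub (integrable_const k)).pos_part).add_measure
      ((hη.sub (integrable_const k)).pos_part)

lemma mid_CX {ρ : ℝ} (hρ : 1 < ρ) {μ η₀ η₁ : Measure ℝ} [IsProbabilityMeasure μ]
    [IsProbabilityMeasure η₀] [IsProbabilityMeasure η₁] (hμ : mom ρ μ ≠ ∞) (hη₀ : mom ρ η₀ ≠ ∞)
    (hη₁ : mom ρ η₁ ≠ ∞) (h₀ : CX μ η₀) (h₁ : CX μ η₁) :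
    CX μ (U01.map fun u => (qf η₀ u + qf η₁ u) / 2) := by
  have iμ := integrable_of_mom hρ hμ
  have i₀ := integrable_of_mom hρ hη₀
  have i₁ := integrable_of_mom hρ hη₁
  have jμ := qf_integrable iμ
  have j₀ := qf_integrable i₀
  have j₁ := qf_integrable i₁
  obtain ⟨m₀, s₀⟩ := qf_order iμ i₀ h₀
  obtain ⟨m₁, s₁⟩ := qf_order iμ i₁ h₁
  have hYm : Measurable fun u => (qf η₀ u + qf η₁ u) / 2 :=
    ((qf_meas η₀).add (qf_meas η₁)).div_const 2
  have hYi : Integrable (fun u => (qf η₀ u + qf η₁ u) / 2) U01 := (j₀.add j₁).div_const 2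
  apply CX.of_lipschitz
  rintro φ hφ hn ⟨K, hK⟩
  obtain ⟨ψ, hψm, hψb, hψ⟩ := subgrad hφ hK
  have hφm : Measurable fun x => ENNReal.ofReal (φ x) := (convex_cont hφ).measurable.ennreal_ofReal
  rw [lintegral_map hφm hYm]
  conv_lhs => rw [← law_qf μ]
  rw [lintegral_map hφm (qf_meas μ)]
  have hφi : ∀ f : ℝ → ℝ, Integrable f U01 → Integrable (fun u => φ (f u)) U01 := by
    intro f hf
    refine ((integrable_const ‖φ 0‖).add (hf.norm.const_mul K)).mono'
      ((convex_cont hφ).comp_aestronglyMeasurable hf.1) (ae_of_all _ fun u => ?_)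
    have := hK.dist_le_mul (f u) 0
    rw [dist_eq_norm, dist_zero_right] at this
    have h2 := norm_sub_norm_le (φ (f u)) (φ 0)
    simp only [Pi.add_apply]
    linarith
  rw [← ofReal_integral_eq_lintegral_ofReal (hφi _ jμ) (ae_of_all _ fun u => hn _),
    ← ofReal_integral_eq_lintegral_ofReal (hφi _ hYi) (ae_of_all _ fun u => hn _)]
  apply ENNReal.ofReal_le_ofReal
  have hgm : Measurable fun u => ψ (qf μ u) := hψm.measurable.comp (qf_meas μ)
  have hgmono : ∀ u ∈ Ioo (0:ℝ) 1, ∀ v ∈ Ioo (0:ℝ) 1, u ≤ v → ψ (qf μ u) ≤ ψ (qf μ v) :=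
    fun u hu v hv h => hψm (qf_mono μ hu hv h)
  have k₀ := mono_int hgm (fun u => hψb _) hgmono (j₀.sub jμ) (by
    simp only [Pi.sub_apply]
    rw [integral_sub j₀ jμ, m₀, sub_self]) s₀
  have k₁ := mono_int hgm (fun u => hψb _) hgmono (j₁.sub jμ) (by
    simp only [Pi.sub_apply]
    rw [integral_sub j₁ jμ, m₁, sub_self]) s₁
  simp only [Pi.sub_apply] at k₀ k₁
  have l₀ : Integrable (fun u => ψ (qf μ u) * (qf η₀ u - qf μ u)) U01 :=
    (j₀.sub jμ).bdd_mul (c := K) hgm.aestronglyMeasurable (ae_of_all _ fun u => hψb _)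
  have l₁ : Integrable (fun u => ψ (qf μ u) * (qf η₁ u - qf μ u)) U01 :=
    (j₁.sub jμ).bdd_mul (c := K) hgm.aestronglyMeasurable (ae_of_all _ fun u => hψb _)
  have lsum : Integrable (fun u => (1/2) * (ψ (qf μ u) * (qf η₀ u - qf μ u)) +
      (1/2) * (ψ (qf μ u) * (qf η₁ u - qf μ u))) U01 := (l₀.const_mul _).add (l₁.const_mul _)
  have hle : ∫ u, (φ (qf μ u) + ((1/2) * (ψ (qf μ u) * (qf η₀ u - qf μ u)) +
      (1/2) * (ψ (qf μ u) * (qf η₁ u - qf μ u)))) ∂U01 ≤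
      ∫ u, φ ((qf η₀ u + qf η₁ u) / 2) ∂U01 := by
    refine integral_mono ((hφi _ jμ).add lsum) (hφi _ hYi)
      fun u => ?_
    have := hψ (qf μ u) ((qf η₀ u + qf η₁ u) / 2)
    simp only
    linarith
  rw [integral_add (hφi _ jμ) lsum,
    integral_add (l₀.const_mul _) (l₁.const_mul _), integral_const_mul, integral_const_mul] at hle
  linarith

end ConvexOrderMid

section OneDim

lemma strict_mid {ρ : ℝ} (hρ : 1 < ρ) (a b : ℝ) :
    ‖(a + b) / 2‖ ^ ρ ≤ (‖a‖ ^ ρ + ‖b‖ ^ ρ) / 2 ∧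
    (‖(a + b) / 2‖ ^ ρ = (‖a‖ ^ ρ + ‖b‖ ^ ρ) / 2 → a = b) := by
  have h1 : ‖(a + b) / 2‖ ≤ (‖a‖ + ‖b‖) / 2 := by
    rw [norm_div, Real.norm_ofNat]
    have := norm_add_le a b
    linarith
  have h2 : ‖(a + b) / 2‖ ^ ρ ≤ ((‖a‖ + ‖b‖) / 2) ^ ρ :=
    Real.rpow_le_rpow (norm_nonneg _) h1 (by linarith)
  have hsc := strictConvexOn_rpow hρ
  by_cases hab : ‖a‖ = ‖b‖
  · have h3 : (‖a‖ + ‖b‖) / 2 = ‖a‖ := by rw [← hab]; ring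
    rw [h3] at h2
    refine ⟨by rw [← hab]; linarith, fun h => ?_⟩
    by_contra hne
    have hneg : a = -b := by
      rcases abs_eq_abs.1 hab with h | h
      · exact absurd h hne
      · exact h
    have h4 : (a + b) / 2 = 0 := by rw [hneg]; ring
    rw [h4, norm_zero, Real.zero_rpow (by linarith), ← hab] at h
    have ha : a ≠ 0 := by
      rintro rfl
      apply hne
      linarith
    have : 0 < ‖a‖ ^ ρ := Real.rpow_pos_of_pos (norm_pos_iff.2 ha) _
    linarith
  · have h3 := hsc.2 (norm_nonneg a) (norm_nonneg b) hab (show (0:ℝ) < 1 / 2 by norm_num)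
      (show (0:ℝ) < 1 / 2 by norm_num) (by norm_num)
    simp only [smul_eq_mul] at h3
    have h4 : 1 / 2 * ‖a‖ + 1 / 2 * ‖b‖ = (‖a‖ + ‖b‖) / 2 := by ring
    rw [h4] at h3
    have h5 : ‖(a + b) / 2‖ ^ ρ < (‖a‖ ^ ρ + ‖b‖ ^ ρ) / 2 := by linarith
    exact ⟨h5.le, fun h => absurd h h5.ne⟩

lemma grd_strictMono {ρ : ℝ} (hρ : 1 < ρ) : StrictMono (grd (E := ℝ) ρ) := by
  rcases (grd_cont (E := ℝ) hρ).strictMono_of_inj (grd_inj hρ) with h | h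
  · exact h
  · have := h (show (0:ℝ) < 1 by norm_num)
    simp [grd] at this
    exact absurd this (by norm_num)

lemma opt_law {ρ : ℝ} (hρ : 1 < ρ) {μ ν : Measure ℝ} [IsProbabilityMeasure ν]
    {π : Measure (ℝ × ℝ)} (h : Opt ρ μ ν π) :
    π = U01.map fun u => (qf ν u, qf (π.map Prod.snd) u) := by
  have := prob_of_map measurable_fst h.1.1
  have key := law_comonotone (P := π) ?_
  · rwa [h.1.1] at key
  · intro p hp p' hp' hlt
    have h1 := monotone_support hρ h hp hp'
    by_contra! hc
    have h2 := grd_strictMono hρ (show p'.2 - p'.1 < p.2 - p.1 by linarith)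
    rw [real_inner_eq_re_inner, RCLike.inner_apply] at h1
    simp at h1
    nlinarith

lemma real_unique {ρ : ℝ} (hρ : 1 < ρ) {μ ν : Measure ℝ} [IsProbabilityMeasure μ]
    [IsProbabilityMeasure ν] (hμ : mom ρ μ ≠ ∞) (hν : mom ρ ν ≠ ∞) {π₀ π₁ : Measure (ℝ × ℝ)}
    (h₀ : Opt ρ μ ν π₀) (h₁ : Opt ρ μ ν π₁) : π₀.map Prod.snd = π₁.map Prod.snd := by
  have p₀ := prob_of_map measurable_fst h₀.1.1
  have p₁ := prob_of_map measurable_fst h₁.1.1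
  have e₀ := opt_law hρ h₀
  have e₁ := opt_law hρ h₁
  have hc : cost ρ π₁ = cost ρ π₀ := le_antisymm (h₁.2.2 _ h₀.1) (h₀.2.2 _ h₁.1)
  have q₀ := Measure.isProbabilityMeasure_map (μ := π₀) measurable_snd.aemeasurable
  have q₁ := Measure.isProbabilityMeasure_map (μ := π₁) measurable_snd.aemeasurable
  have hmom : ∀ π : Measure (ℝ × ℝ), Opt ρ μ ν π → mom ρ (π.map Prod.snd) ≠ ∞ := by
    intro π h
    refine ne_top_of_le_ne_top ?_ (mom_snd_le (by linarith) π)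
    rw [h.1.1]
    have := h.2.1
    finiteness
  have m₀ := hmom _ h₀
  have m₁ := hmom _ h₁
  have c₀ := h₀.1.2
  have c₁ := h₁.1.2
  set η₀ := π₀.map Prod.snd with hη₀
  set η₁ := π₁.map Prod.snd with hη₁
  have hcx := mid_CX hρ hμ m₀ m₁ c₀ c₁
  have hmY : Measurable fun u => (qf η₀ u + qf η₁ u) / 2 :=
    ((qf_meas η₀).add (qf_meas η₁)).div_const 2
  have hadm : Adm μ ν (U01.map fun u => (qf ν u, (qf η₀ u + qf η₁ u) / 2)) := by
    constructor
    · rw [Measure.map_map measurable_fst ((qf_meas ν).prodMk hmY)]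
      exact law_qf ν
    · rw [Measure.map_map measurable_snd ((qf_meas ν).prodMk hmY)]
      exact hcx
  have hle := h₀.2.2 _ hadm
  have hcost : ∀ Y : ℝ → ℝ, Measurable Y → cost ρ (U01.map fun u => (qf ν u, Y u)) =
      ∫⁻ u, ENNReal.ofReal (‖qf ν u - Y u‖ ^ ρ) ∂U01 := by
    intro Y hY
    unfold cost
    rw [lintegral_map (cost_meas ρ) ((qf_meas ν).prodMk hY)]
  rw [hcost _ hmY] at hle
  have k₀ : cost ρ π₀ = ∫⁻ u, ENNReal.ofReal (‖qf ν u - qf η₀ u‖ ^ ρ) ∂U01 := by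
    rw [← hcost _ (qf_meas η₀), ← e₀]
  have k₁ : cost ρ π₀ = ∫⁻ u, ENNReal.ofReal (‖qf ν u - qf η₁ u‖ ^ ρ) ∂U01 := by
    rw [← hcost _ (qf_meas η₁), ← e₁, hc]
  have hmeas : ∀ Y : ℝ → ℝ, Measurable Y →
      Measurable fun u => ENNReal.ofReal (‖qf ν u - Y u‖ ^ ρ) :=
    fun Y hY => meas_norm_rpow ((qf_meas ν).sub hY) ρ
  have heq : ∀ u, qf ν u - (qf η₀ u + qf η₁ u) / 2
      = ((qf ν u - qf η₀ u) + (qf ν u - qf η₁ u)) / 2 := fun u => by ring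
  let g : ℝ → ℝ≥0∞ := fun u => 2⁻¹ * (ENNReal.ofReal (‖qf ν u - qf η₀ u‖ ^ ρ)
    + ENNReal.ofReal (‖qf ν u - qf η₁ u‖ ^ ρ))
  have hg : ∀ u, g u = ENNReal.ofReal ((‖qf ν u - qf η₀ u‖ ^ ρ + ‖qf ν u - qf η₁ u‖ ^ ρ) / 2) := by
    intro u
    simp only [g]
    rw [← ENNReal.ofReal_add (by positivity) (by positivity), div_eq_inv_mul,
      ENNReal.ofReal_mul (by norm_num), ENNReal.ofReal_inv_of_pos (by norm_num)]
    simp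
  have hgm : Measurable g := ((hmeas _ (qf_meas η₀)).add (hmeas _ (qf_meas η₁))).const_mul _
  have hgint : ∫⁻ u, g u ∂U01 = cost ρ π₀ := by
    simp only [g]
    rw [lintegral_const_mul' _ _ (by simp),
      lintegral_add_left (hmeas _ (qf_meas η₀)), ← k₀, ← k₁, half_add']
  have hfg : ∀ u, ENNReal.ofReal (‖qf ν u - (qf η₀ u + qf η₁ u) / 2‖ ^ ρ) ≤ g u := by
    intro u
    rw [hg, heq]
    exact ENNReal.ofReal_le_ofReal (strict_mid hρ _ _).1
  have hae := ae_eq_of_ae_le_of_lintegral_le (μ := U01) (ae_of_all _ hfg) (by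
    refine ne_top_of_le_ne_top ?_ (lintegral_mono hfg)
    rw [hgint]; exact h₀.2.1) hgm.aemeasurable (by rw [hgint]; exact hle)
  have hYY : qf η₀ =ᵐ[U01] qf η₁ := by
    filter_upwards [hae] with u hu
    rw [hg, heq, ENNReal.ofReal_eq_ofReal_iff (by positivity) (by positivity)] at hu
    have := (strict_mid hρ _ _).2 hu
    linarith
  rw [← law_qf η₀, ← law_qf η₁]
  exact Measure.map_congr hYY

end OneDim

section Transfer

set_option linter.unusedSectionVars false

variable {E : Type*} [NormedAddCommGroup E] [InnerProductSpace ℝ E] [FiniteDimensional ℝ E]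
  [MeasurableSpace E] [BorelSpace E]
variable {F : Type*} [NormedAddCommGroup F] [InnerProductSpace ℝ F] [FiniteDimensional ℝ F]
  [MeasurableSpace F] [BorelSpace F]

lemma prodMap_meas (e : E ≃ₗᵢ[ℝ] F) : Measurable (Prod.map e e) :=
  e.continuous.measurable.prodMap e.continuous.measurable

lemma adm_map (e : E ≃ₗᵢ[ℝ] F) {μ ν : Measure E} {π : Measure (E × E)} (h : Adm μ ν π) :
    Adm (μ.map e) (ν.map e) (π.map (Prod.map e e)) := by
  have he : Measurable e := e.continuous.measurable
  constructor
  · rw [Measure.map_map measurable_fst (prodMap_meas e), ← h.1, Measure.map_map he measurable_fst]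
    rfl
  · have : (π.map (Prod.map e e)).map Prod.snd = (π.map Prod.snd).map e := by
      rw [Measure.map_map measurable_snd (prodMap_meas e), Measure.map_map he measurable_snd]
      rfl
    rw [this]
    intro φ hφ hn
    have hm : Measurable fun x => ENNReal.ofReal (φ x) := (convex_cont hφ).measurable.ennreal_ofReal
    rw [lintegral_map hm he, lintegral_map hm he]
    refine h.2 (fun x => φ (e x)) ?_ (fun x => hn _)
    exact hφ.comp_linearMap e.toLinearEquiv.toLinearMap

lemma cost_map (e : E ≃ₗᵢ[ℝ] F) (ρ : ℝ) (π : Measure (E × E)) :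
    cost ρ (π.map (Prod.map e e)) = cost ρ π := by
  unfold cost
  rw [lintegral_map (cost_meas ρ) (prodMap_meas e)]
  simp only [Prod.map_fst, Prod.map_snd, ← map_sub, LinearIsometryEquiv.norm_map]

lemma mom_map_iso (e : E ≃ₗᵢ[ℝ] F) (ρ : ℝ) (m : Measure E) : mom ρ (m.map e) = mom ρ m := by
  rw [mom_map e.continuous.measurable]
  simp [mom]

lemma map_symm_map (e : E ≃ₗᵢ[ℝ] F) (m : Measure E) : (m.map e).map e.symm = m := by
  rw [Measure.map_map e.symm.continuous.measurable e.continuous.measurable]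
  simp [Function.comp_def]

lemma opt_map (e : E ≃ₗᵢ[ℝ] F) {ρ : ℝ} {μ ν : Measure E} {π : Measure (E × E)}
    (h : Opt ρ μ ν π) : Opt ρ (μ.map e) (ν.map e) (π.map (Prod.map e e)) := by
  refine ⟨adm_map e h.1, by rw [cost_map]; exact h.2.1, fun π' h' => ?_⟩
  have h2 := adm_map e.symm h'
  rw [map_symm_map, map_symm_map] at h2
  rw [cost_map, ← cost_map e.symm]
  exact h.2.2 _ h2

lemma one_dim_unique (e : E ≃ₗᵢ[ℝ] ℝ) {ρ : ℝ} (hρ : 1 < ρ) {μ ν : Measure E}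
    [IsProbabilityMeasure μ] [IsProbabilityMeasure ν] (hμ : mom ρ μ ≠ ∞) (hν : mom ρ ν ≠ ∞)
    {π₀ π₁ : Measure (E × E)}
    (h₀ : Opt ρ μ ν π₀) (h₁ : Opt ρ μ ν π₁) : π₀.map Prod.snd = π₁.map Prod.snd := by
  have he : Measurable e := e.continuous.measurable
  have i1 := Measure.isProbabilityMeasure_map (μ := μ) he.aemeasurable
  have i2 := Measure.isProbabilityMeasure_map (μ := ν) he.aemeasurable
  have key := real_unique hρ (by rwa [mom_map_iso]) (by rwa [mom_map_iso])
    (opt_map e h₀) (opt_map e h₁)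
  have : ∀ π : Measure (E × E), (π.map (Prod.map e e)).map Prod.snd = (π.map Prod.snd).map e := by
    intro π
    rw [Measure.map_map measurable_snd (prodMap_meas e), Measure.map_map he measurable_snd]
    rfl
  rw [this, this] at key
  rw [← map_symm_map e (π₀.map Prod.snd), key, map_symm_map]

end Transfer

section Final

set_option linter.unusedSectionVars false

variable {E : Type*} [NormedAddCommGroup E] [InnerProductSpace ℝ E] [FiniteDimensional ℝ E]
  [MeasurableSpace E] [BorelSpace E]

lemma mom_ne_top {ρ : ℝ} {m : Measure E} (h : Integrable (fun x => ‖x‖ ^ ρ) m) : mom ρ m ≠ ∞ := by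
  have := h.2
  rw [hasFiniteIntegral_iff_ofReal (ae_of_all _ fun x => by positivity)] at this
  exact this.ne

theorem final {ρ : ℝ} (hρ : 1 < ρ) (μ ν : Measure E)
    [IsProbabilityMeasure μ] [IsProbabilityMeasure ν]
    (hμ : mom ρ μ ≠ ∞) (hν : mom ρ ν ≠ ∞)
    (huniq : ∀ π₀ π₁ : Measure (E × E), Opt ρ μ ν π₀ → Opt ρ μ ν π₁ →
      π₀.map Prod.snd = π₁.map Prod.snd) :
    ∃! η : Measure E,
      IsProbabilityMeasure η ∧ ConvexOrder μ η
      ∧ Wp ρ ν η = ⨅ (η' : Measure E)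
          (_ : IsProbabilityMeasure η') (_ : ConvexOrder μ η'), Wp ρ ν η' := by
  obtain ⟨π, hπ⟩ := exists_opt hρ hμ hν
  have hprob := prob_of_map measurable_fst hπ.1.1
  have hprob2 := Measure.isProbabilityMeasure_map (μ := π) measurable_snd.aemeasurable
  have hinf : (⨅ (η' : Measure E) (_ : IsProbabilityMeasure η') (_ : ConvexOrder μ η'),
      Wp ρ ν η') = cost ρ π := by
    apply le_antisymm
    · refine iInf_le_of_le (π.map Prod.snd) (iInf_le_of_le hprob2
        (iInf_le_of_le hπ.1.2.convexOrder ?_))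
      exact iInf_le_of_le π (iInf_le_of_le hπ.1.1 (iInf_le_of_le rfl le_rfl))
    · refine le_iInf fun η' => le_iInf fun _ => le_iInf fun ho => ?_
      refine le_iInf fun π' => le_iInf fun h1 => le_iInf fun h2 => ?_
      refine hπ.2.2 π' ⟨h1, ?_⟩
      rw [h2]
      exact ho.1
  rw [hinf]
  refine ⟨π.map Prod.snd, ⟨hprob2, hπ.1.2.convexOrder, ?_⟩, ?_⟩
  · apply le_antisymm
    · exact iInf_le_of_le π (iInf_le_of_le hπ.1.1 (iInf_le_of_le rfl le_rfl))
    · rw [← hinf]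
      exact iInf_le_of_le (π.map Prod.snd) (iInf_le_of_le hprob2
        (iInf_le_of_le hπ.1.2.convexOrder le_rfl))
  · rintro η ⟨hη, ho, hW⟩
    obtain ⟨π', h1, h2, h3⟩ := exists_opt_coupling hρ hν (η := η) (by rw [hW]; exact hπ.2.1)
    rw [← h2]
    refine huniq _ _ ⟨⟨h1, by rw [h2]; exact ho.1⟩, ?_, ?_⟩ hπ
    · rw [h3, hW]; exact hπ.2.1
    · intro πc hcc
      rw [h3, hW]; exact hπ.2.2 _ hcc

end Final

end CxProj

theorem stmt12 {d : ℕ} (ρ : ℝ) (hρ : 1 < ρ)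
    (μ ν : Measure (EuclideanSpace ℝ (Fin d)))
    [IsProbabilityMeasure μ] [IsProbabilityMeasure ν]
    (hμρ : Integrable (fun x => ‖x‖ ^ ρ) μ) (hνρ : Integrable (fun x => ‖x‖ ^ ρ) ν)
    (hac : ν ≪ (volume : Measure (EuclideanSpace ℝ (Fin d))) ∨ d = 1) :
    ∃! η : Measure (EuclideanSpace ℝ (Fin d)),
      IsProbabilityMeasure η ∧ ConvexOrder μ η
      ∧ Wp ρ ν η = ⨅ (η' : Measure (EuclideanSpace ℝ (Fin d)))
          (_ : IsProbabilityMeasure η') (_ : ConvexOrder μ η'), Wp ρ ν η' := by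
  have hμ := CxProj.mom_ne_top hμρ
  have hν := CxProj.mom_ne_top hνρ
  refine CxProj.final hρ μ ν hμ hν fun π₀ π₁ h₀ h₁ => ?_
  rcases hac with hac | rfl
  · rw [CxProj.ac_unique hρ volume hac h₀ h₁]
  · have e : EuclideanSpace ℝ (Fin 1) ≃ₗᵢ[ℝ] ℝ :=
      (OrthonormalBasis.singleton (Fin 1) ℝ).repr.symm
    exact CxProj.one_dim_unique e hρ hμ hν h₀ h₁
end
end
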